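/- Let n ≥ 8 and τ be integers with n² − 3n ≤ τ ≤ n² − 2n − 1, and set σ = n² − τ (so 2n + 1 ≤ σ ≤ 3n). Assume σ − 2n ≡ 2 (mod 3) and 3n − σ is odd. Then μ(n,τ) = 4 · 6^{⌊(σ−2n)/3⌋} · 2^{⌊(3n−σ)/2⌋}, and for A ∈ 𝒰(n,τ), per A = μ(n,τ) if and only if A is combinatorially equivalent to N_{n,σ} = A₃ ⊕ J_3 ⊕ ⋯ ⊕ J_3 ⊕ J_2 ⊕ ⋯ ⊕ J_2, where A₃ is the 3×3 matrix equal to J_3 except that its (1,1) entry is 0, and the numbers of J_3 and J_2 blocks are chosen so the whole matrix has order n and exactly σ ones. -/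

import Mathlib

open scoped BigOperators

namespace BGM

/-- The permanent of a square matrix with natural number entries. -/
def perm {n : ℕ} (M : Matrix (Fin n) (Fin n) ℕ) : ℕ :=
  ∑ φ : Equiv.Perm (Fin n), ∏ i, M i (φ i)

/-- `M` is a (0,1)-matrix. -/
def IsZeroOne {n : ℕ} (M : Matrix (Fin n) (Fin n) ℕ) : Prop :=
  ∀ i j, M i j = 0 ∨ M i j = 1

/-- The number of entries of `M` equal to `0`. -/
def zeroCount {n : ℕ} (M : Matrix (Fin n) (Fin n) ℕ) : ℕ :=
  (Finset.univ.filter fun p : Fin n × Fin n => M p.1 p.2 = 0).card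

/-- `𝒰(n, τ)`: the n×n (0,1)-matrices with exactly τ zero entries. -/
def Uclass (n τ : ℕ) : Set (Matrix (Fin n) (Fin n) ℕ) :=
  {M | IsZeroOne M ∧ zeroCount M = τ}

/-- `μ(n, τ) = max {per A : A ∈ 𝒰(n, τ)}`. -/
noncomputable def mu (n τ : ℕ) : ℕ :=
  sSup (perm '' Uclass n τ)

/-- `𝒜(n, k)`: the n×n (0,1)-matrices with exactly k ones in each row and column. -/
def Aclass (n k : ℕ) : Set (Matrix (Fin n) (Fin n) ℕ) :=
  {M | IsZeroOne M ∧ (∀ i, ∑ j, M i j = k) ∧ (∀ j, ∑ i, M i j = k)}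

/-- `P` is a permutation matrix. -/
def IsPermMatrix {n : ℕ} (P : Matrix (Fin n) (Fin n) ℕ) : Prop :=
  ∃ e : Equiv.Perm (Fin n), ∀ i j, P i j = if j = e i then 1 else 0

/-- `A` and `B` are combinatorially equivalent: `B = PAQ` or `B = PAᵀQ` for
permutation matrices `P`, `Q`. -/
def CombEquiv {n : ℕ} (A B : Matrix (Fin n) (Fin n) ℕ) : Prop :=
  ∃ P Q, IsPermMatrix P ∧ IsPermMatrix Q ∧ (B = P * A * Q ∨ B = P * A.transpose * Q)

/-- Index of the block (of consecutive sizes `L`) containing position `i`. -/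
def blockIdx : List ℕ → ℕ → ℕ
  | [], _ => 0
  | s :: L, i => if i < s then 0 else blockIdx L (i - s) + 1

/-- The n×n block-diagonal direct sum of all-ones blocks of sizes `L`
(with `L.sum = n`). -/
def listBlocks (n : ℕ) (L : List ℕ) : Matrix (Fin n) (Fin n) ℕ :=
  Matrix.of fun i j => if blockIdx L (i : ℕ) = blockIdx L (j : ℕ) then 1 else 0

/-- The n×n block-diagonal matrix with a head block `B` (of size `m`) followed by
all-ones blocks of sizes `L` (with `m + L.sum = n`). -/
def headBlocks (n : ℕ) {m : ℕ} (B : Matrix (Fin m) (Fin m) ℕ) (L : List ℕ) :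
    Matrix (Fin n) (Fin n) ℕ :=
  Matrix.of fun i j =>
    if h : (i : ℕ) < m ∧ (j : ℕ) < m then B ⟨(i : ℕ), h.1⟩ ⟨(j : ℕ), h.2⟩
    else if m ≤ (i : ℕ) ∧ m ≤ (j : ℕ) ∧
        blockIdx L ((i : ℕ) - m) = blockIdx L ((j : ℕ) - m) then 1 else 0

/-- `M` with the `(i0, j0)` entry changed to `1`. -/
def setOne {n : ℕ} (M : Matrix (Fin n) (Fin n) ℕ) (i0 j0 : Fin n) :
    Matrix (Fin n) (Fin n) ℕ :=
  Matrix.of fun i j => if i = i0 ∧ j = j0 then 1 else M i j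

/-- `J₃ - I₃`. -/
def J3mI3 : Matrix (Fin 3) (Fin 3) ℕ := Matrix.of fun i j => if i = j then 0 else 1

/-- `J₄ - I₄`. -/
def J4mI4 : Matrix (Fin 4) (Fin 4) ℕ := Matrix.of fun i j => if i = j then 0 else 1

/-- `A₃`: the 3×3 all-ones matrix except the (1,1) entry is 0. -/
def A3 : Matrix (Fin 3) (Fin 3) ℕ := Matrix.of fun i j => if i = 0 ∧ j = 0 then 0 else 1

/-- `A₃ ⊕ I₂`. -/
def V5 : Matrix (Fin 5) (Fin 5) ℕ :=
  !![0,1,1,0,0; 1,1,1,0,0; 1,1,1,0,0; 0,0,0,1,0; 0,0,0,0,1]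

/-- `J₃ ⊕ I₂`. -/
def S5 : Matrix (Fin 5) (Fin 5) ℕ :=
  !![1,1,1,0,0; 1,1,1,0,0; 1,1,1,0,0; 0,0,0,1,0; 0,0,0,0,1]

/-- The head block of `W`. -/
def BW : Matrix (Fin 4) (Fin 4) ℕ :=
  !![0,0,1,1; 1,1,0,1; 1,1,1,0; 1,1,0,1]

/-- The head block of `X`. -/
def BX : Matrix (Fin 4) (Fin 4) ℕ :=
  !![0,0,1,1; 1,0,1,1; 1,1,0,1; 1,1,1,0]

/-- The head block of `Y`. -/
def BY : Matrix (Fin 4) (Fin 4) ℕ :=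
  !![0,0,1,1; 1,0,1,1; 1,1,0,0; 1,1,1,1]

/-- `A₃ ⊕ I₁`. -/
def T4 : Matrix (Fin 4) (Fin 4) ℕ :=
  !![0,1,1,0; 1,1,1,0; 1,1,1,0; 0,0,0,1]

/-- `A₄ ⊕ J₂`, where `A₄` is `J₄` with the (1,1) entry changed to 0. -/
def Q6 : Matrix (Fin 6) (Fin 6) ℕ :=
  !![0,1,1,1,0,0; 1,1,1,1,0,0; 1,1,1,1,0,0; 1,1,1,1,0,0; 0,0,0,0,1,1; 0,0,0,0,1,1]

/-- `J₃ ⊕ I₁`. -/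
def M4 : Matrix (Fin 4) (Fin 4) ℕ :=
  !![1,1,1,0; 1,1,1,0; 1,1,1,0; 0,0,0,1]

end BGM

namespace BGM
section Comb
set_option linter.unusedSectionVars false
variable {ι : Type} [DecidableEq ι]

/-- transposed relation -/
abbrev tr (A : ι → ι → Bool) : ι → ι → Bool := fun i j => A j i

open Classical in
/-- perfect matchings between `S` and `T` -/
noncomputable def PM (A : ι → ι → Bool) (S T : Finset ι) : Finset (Finset (ι × ι)) :=
  (S ×ˢ T).powerset.filter fun M => (∀ p ∈ M, A p.1 p.2 = true) ∧
    (∀ i ∈ S, ∃! j, (i, j) ∈ M) ∧ (∀ j ∈ T, ∃! i, (i, j) ∈ M)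

noncomputable def pr (A : ι → ι → Bool) (S T : Finset ι) : ℕ := (PM A S T).card

/-- support of row `i` -/
def row (A : ι → ι → Bool) (T : Finset ι) (i : ι) : Finset ι := T.filter fun j => A i j = true

def ones (A : ι → ι → Bool) (S T : Finset ι) : ℕ := ∑ i ∈ S, (row A T i).card

lemma mem_PM {A : ι → ι → Bool} {S T : Finset ι} {M} : M ∈ PM A S T ↔
    (∀ p ∈ M, p.1 ∈ S ∧ p.2 ∈ T) ∧ (∀ p ∈ M, A p.1 p.2 = true) ∧
    (∀ i ∈ S, ∃! j, (i, j) ∈ M) ∧ (∀ j ∈ T, ∃! i, (i, j) ∈ M) := by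
  simp only [PM, Finset.mem_filter, Finset.mem_powerset]
  refine and_congr ⟨fun h p hp => by simpa using h hp, fun h p hp => by simpa using h p hp⟩ Iff.rfl

lemma mem_row {A : ι → ι → Bool} {T : Finset ι} {i j : ι} :
    j ∈ row A T i ↔ j ∈ T ∧ A i j = true := by simp [row]

lemma pr_expand (A : ι → ι → Bool) {S T : Finset ι} {i : ι} (hi : i ∈ S) :
    pr A S T = ∑ j ∈ row A T i, pr A (S.erase i) (T.erase j) := by
  unfold pr
  rw [← Finset.card_sigma]
  symm
  refine Finset.card_bij (fun x _ => insert (i, x.1) x.2) ?_ ?_ ?_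
  · rintro ⟨j, M⟩ h
    simp only [Finset.mem_sigma, mem_row, mem_PM] at h ⊢
    obtain ⟨⟨hj, hA⟩, h1, h2, h3, h4⟩ := h
    refine ⟨?_, ?_, ?_, ?_⟩
    · intro p hp
      rcases Finset.mem_insert.1 hp with rfl | hp
      · exact ⟨hi, hj⟩
      · have := h1 p hp
        exact ⟨Finset.mem_of_mem_erase this.1, Finset.mem_of_mem_erase this.2⟩
    · intro p hp
      rcases Finset.mem_insert.1 hp with rfl | hp
      · exact hA
      · exact h2 p hp
    · intro a ha
      by_cases hai : a = i
      · subst hai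
        refine ⟨j, by simp, ?_⟩
        intro b hb
        simp only [Finset.mem_insert, Prod.mk.injEq, true_and] at hb
        rcases hb with hb | hb
        · exact hb
        · have := (h1 _ hb).1
          simp at this
      · obtain ⟨b, hb, hu⟩ := h3 a (Finset.mem_erase.2 ⟨hai, ha⟩)
        refine ⟨b, Finset.mem_insert_of_mem hb, ?_⟩
        intro c hc
        simp only [Finset.mem_insert, Prod.mk.injEq, hai, false_and, false_or] at hc
        exact hu c hc
    · intro a ha
      by_cases hai : a = j
      · subst hai
        refine ⟨i, by simp, ?_⟩
        intro b hb
        simp only [Finset.mem_insert, Prod.mk.injEq, and_true] at hb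
        rcases hb with hb | hb
        · exact hb
        · have := (h1 _ hb).2
          simp at this
      · obtain ⟨b, hb, hu⟩ := h4 a (Finset.mem_erase.2 ⟨hai, ha⟩)
        refine ⟨b, Finset.mem_insert_of_mem hb, ?_⟩
        intro c hc
        simp only [Finset.mem_insert, Prod.mk.injEq, hai, and_false, false_or] at hc
        exact hu c hc
  · rintro ⟨j, M⟩ h ⟨j', M'⟩ h' heq
    simp only [Finset.mem_sigma, mem_row, mem_PM] at h h' heq
    obtain ⟨_, h1, _⟩ := h
    obtain ⟨_, h1', _⟩ := h'
    have hM : ∀ b, (i, b) ∉ M := fun b hb => by simpa using (h1 _ hb).1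
    have hM' : ∀ b, (i, b) ∉ M' := fun b hb => by simpa using (h1' _ hb).1
    have hjj : j = j' := by
      have : (i, j) ∈ insert (i, j') M' := heq ▸ Finset.mem_insert_self _ _
      simpa [hM'] using this
    subst hjj
    have : M = M' := by
      rw [← Finset.erase_insert (hM j), heq, Finset.erase_insert (hM' j)]
    subst this
    rfl
  · intro M hM
    rw [mem_PM] at hM
    obtain ⟨h1, h2, h3, h4⟩ := hM
    obtain ⟨j, hj, hu⟩ := h3 i hi
    refine ⟨⟨j, M.erase (i, j)⟩, ?_, Finset.insert_erase hj⟩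
    simp only [Finset.mem_sigma, mem_row, mem_PM]
    have hjT := (h1 _ hj).2
    obtain ⟨i', hi', hu'⟩ := h4 j hjT
    have hii' := hu' i hj
    refine ⟨⟨hjT, h2 _ hj⟩, ?_, ?_, ?_, ?_⟩
    · rintro ⟨a, b⟩ hp
      rw [Finset.mem_erase] at hp
      have := h1 _ hp.2
      simp only [Finset.mem_erase]
      refine ⟨⟨?_, this.1⟩, ⟨?_, this.2⟩⟩
      · rintro rfl
        exact hp.1 (by rw [hu b hp.2])
      · rintro rfl
        exact hp.1 (by rw [hu' a hp.2, hii'])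
    · intro p hp
      exact h2 p (Finset.mem_of_mem_erase hp)
    · intro a ha
      rw [Finset.mem_erase] at ha
      obtain ⟨b, hb, hub⟩ := h3 a ha.2
      refine ⟨b, by simp [ha.1, hb], ?_⟩
      intro c hc
      exact hub c (Finset.mem_of_mem_erase hc)
    · intro a ha
      rw [Finset.mem_erase] at ha
      obtain ⟨b, hb, hub⟩ := h4 a ha.2
      refine ⟨b, by simp [ha.1, hb], ?_⟩
      intro c hc
      exact hub c (Finset.mem_of_mem_erase hc)

lemma pr_tr (A : ι → ι → Bool) (S T : Finset ι) : pr (tr A) T S = pr A S T := by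
  have key : ∀ (A : ι → ι → Bool) (S T : Finset ι) M, M ∈ PM A S T →
      M.image Prod.swap ∈ PM (tr A) T S := by
    intro A S T M hM
    have hmem : ∀ a b, (a, b) ∈ M.image Prod.swap ↔ (b, a) ∈ M := by
      intro a b
      simp only [Finset.mem_image, Prod.exists, Prod.swap_prod_mk, Prod.mk.injEq]
      constructor
      · rintro ⟨x, y, h, rfl, rfl⟩; exact h
      · intro h; exact ⟨b, a, h, rfl, rfl⟩
    rw [mem_PM] at hM ⊢
    obtain ⟨h1, h2, h3, h4⟩ := hM
    refine ⟨?_, ?_, ?_, ?_⟩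
    · rintro ⟨a, b⟩ hp
      exact (h1 _ ((hmem a b).1 hp)).symm
    · rintro ⟨a, b⟩ hp
      exact h2 _ ((hmem a b).1 hp)
    · intro i hi
      simpa only [hmem] using h4 i hi
    · intro i hi
      simpa only [hmem] using h3 i hi
  have hss : ∀ M : Finset (ι × ι), (M.image Prod.swap).image Prod.swap = M := by
    intro M; rw [Finset.image_image]; simp
  unfold pr
  refine Finset.card_bij' (fun M _ => M.image Prod.swap) (fun M _ => M.image Prod.swap)
    (fun M hM => key (tr A) T S M hM) (fun M hM => key A S T M hM) (fun M _ => hss M)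
    (fun M _ => hss M)

lemma pr_congr {A B : ι → ι → Bool} {S T : Finset ι}
    (h : ∀ i ∈ S, ∀ j ∈ T, A i j = B i j) : pr A S T = pr B S T := by
  unfold pr
  congr 1
  ext M
  rw [mem_PM, mem_PM]
  refine and_congr_right fun h1 => and_congr_left fun _ => ?_
  refine forall₂_congr fun p hp => ?_
  rw [h _ (h1 p hp).1 _ (h1 p hp).2]

lemma pr_empty (A : ι → ι → Bool) : pr A ∅ ∅ = 1 := by
  unfold pr
  rw [Finset.card_eq_one]
  refine ⟨∅, ?_⟩
  ext M
  rw [mem_PM, Finset.mem_singleton]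
  constructor
  · intro h
    rw [Finset.eq_empty_iff_forall_notMem]
    intro p hp
    simpa using (h.1 p hp).1
  · rintro rfl; simp

lemma ones_tr (A : ι → ι → Bool) (S T : Finset ι) : ones (tr A) T S = ones A S T := by
  unfold ones row
  exact (Finset.sum_card_bipartiteAbove_eq_sum_card_bipartiteBelow (s := T) (t := S)
    (fun j i => A i j = true))

lemma row_erase (A : ι → ι → Bool) (T : Finset ι) (i j : ι) :
    row A (T.erase j) i = (row A T i).erase j := by
  ext x; simp [row, and_assoc]

lemma ones_split (A : ι → ι → Bool) {S T : Finset ι} {i : ι} (hi : i ∈ S) :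
    ones A S T = ones A (S.erase i) T + (row A T i).card := by
  unfold ones
  rw [Finset.sum_erase_add _ _ hi]

lemma ones_minor (A : ι → ι → Bool) {S T : Finset ι} {i j : ι} (hi : i ∈ S) (hj : j ∈ row A T i) :
    ones A S T + 1 =
      ones A (S.erase i) (T.erase j) + (row A T i).card + (row (tr A) S j).card := by
  have hjT := (mem_row.1 hj).1
  rw [ones_split A hi, ← ones_tr A (S.erase i) T, ones_split (tr A) hjT, ones_tr, row_erase]
  have : i ∈ row (tr A) S j := mem_row.2 ⟨hi, (mem_row.1 hj).2⟩
  rw [Finset.card_erase_of_mem this]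
  have := Finset.card_pos.2 ⟨i, this⟩
  omega

end Comb
end BGM

namespace BGM
section Comb2
set_option linter.unusedSectionVars false
variable {ι : Type} [DecidableEq ι]

noncomputable def w : ℝ := (2 / 9 : ℝ) ^ ((1 : ℝ) / 6)

lemma w_pos : 0 < w := by unfold w; positivity

lemma w6 : w ^ 6 = 2 / 9 := by
  unfold w
  rw [← Real.rpow_natCast, ← Real.rpow_mul (by norm_num)]
  norm_num

lemma w_lo : 0.7782 < w := by
  by_contra h
  push Not at h
  have := pow_le_pow_left₀ w_pos.le h 6
  rw [w6] at this
  norm_num at this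

lemma w_hi : w < 0.7783 := by
  by_contra h
  push Not at h
  have := pow_le_pow_left₀ (by norm_num) h 6
  rw [w6] at this
  norm_num at this

lemma w2_lo : 0.6055 < w ^ 2 := by nlinarith [w_lo]
lemma w2_hi : w ^ 2 < 0.6058 := by nlinarith [w_hi, w_pos]
lemma w3_lo : 0.4711 < w ^ 3 := by nlinarith [w_lo, w2_lo]
lemma w3_hi : w ^ 3 < 0.4716 := by nlinarith [w_hi, w_pos, w2_hi]
lemma w5_lo : 0.8557 < 3 * w ^ 5 := by
  have : w ^ 5 = w ^ 2 * w ^ 3 := by ring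
  nlinarith [w2_lo, w3_lo]
lemma w5_hi : 3 * w ^ 5 < 0.858 := by
  have : w ^ 5 = w ^ 2 * w ^ 3 := by ring
  nlinarith [w2_hi, w3_hi, w2_lo, w3_lo]
lemma w4_hi : w ^ 4 < 0.36700 := by
  have : w ^ 4 = w ^ 2 * w ^ 2 := by ring
  nlinarith [w2_hi, w2_lo]
lemma w4_lo : 0.3666 < w ^ 4 := by
  have : w ^ 4 = w ^ 2 * w ^ 2 := by ring
  nlinarith [w2_hi, w2_lo]
lemma w8 : w ^ 8 = 2 / 9 * w ^ 2 := by rw [← w6]; ring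
lemma w7 : w ^ 7 = 2 / 9 * w := by rw [← w6]; ring
lemma wpow_anti {a b : ℕ} (h : a ≤ b) : w ^ b ≤ w ^ a :=
  pow_le_pow_of_le_one w_pos.le (by linarith [w_hi]) h

noncomputable def D (A : ι → ι → Bool) (S T : Finset ι) : ℝ :=
  pr A S T * w ^ ones A S T * (3 / 2 * w) ^ S.card

lemma D_nonneg (A : ι → ι → Bool) (S T : Finset ι) : 0 ≤ D A S T := by
  have := w_pos
  unfold D; positivity

lemma D_tr (A : ι → ι → Bool) {S T : Finset ι} (h : S.card = T.card) :
    D (tr A) T S = D A S T := by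
  unfold D; rw [pr_tr, ones_tr, h]

lemma D_expand (A : ι → ι → Bool) {S T : Finset ι} {i : ι} (hi : i ∈ S) :
    D A S T = ∑ j ∈ row A T i, D A (S.erase i) (T.erase j) *
      (3 / 2 * w ^ ((row A T i).card + (row (tr A) S j).card)) := by
  unfold D
  rw [pr_expand A hi]
  push_cast
  rw [Finset.sum_mul, Finset.sum_mul]
  refine Finset.sum_congr rfl fun j hj => ?_
  have h1 := ones_minor A hi hj
  have h2 : S.card = (S.erase i).card + 1 := (Finset.card_erase_add_one hi).symm
  rw [h2, pow_succ (3 / 2 * w)]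
  have h3 : w ^ ones A S T * w = w ^ ones A (S.erase i) (T.erase j) *
      w ^ ((row A T i).card + (row (tr A) S j).card) := by
    rw [← pow_succ, h1, add_assoc, pow_add]
  linear_combination (pr A (S.erase i) (T.erase j) : ℝ) * (3 / 2 * w) ^ (S.erase i).card * (3/2) * h3

/-- the inductive hypothesis -/
def Small (ι : Type) [DecidableEq ι] (N : ℕ) : Prop := ∀ (B : ι → ι → Bool) (S T : Finset ι),
  S.card = T.card → S.card < N → D B S T ≤ 1

structure Blk (A : ι → ι → Bool) (S T R C : Finset ι) : Prop where
  rs : R ⊆ S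
  ct : C ⊆ T
  row_eq : ∀ i ∈ R, row A T i = C
  col_eq : ∀ j ∈ C, row (tr A) S j = R

lemma Blk.tr {A : ι → ι → Bool} {S T R C : Finset ι} (h : Blk A S T R C) :
    Blk (tr A) T S C R := ⟨h.ct, h.rs, h.col_eq, h.row_eq⟩

def JOne (A : ι → ι → Bool) (S T : Finset ι) : Prop := ∃ i ∈ S, ∃ j ∈ T,
  ones A S T = ones A (S.erase i) (T.erase j) + 1 ∧
  D A S T = D A (S.erase i) (T.erase j) * (3 / 2 * w ^ 2)

lemma JOne.tr {A : ι → ι → Bool} {S T : Finset ι} (hc : S.card = T.card) (h : JOne A S T) :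
    JOne (tr A) T S := by
  obtain ⟨i, hi, j, hj, h1, h2⟩ := h
  refine ⟨j, hj, i, hi, ?_, ?_⟩
  · rw [ones_tr A S T, ones_tr A (S.erase i) (T.erase j), h1]
  · rw [D_tr A hc, D_tr A (S := S.erase i) (T := T.erase j)
      (by rw [Finset.card_erase_of_mem hi, Finset.card_erase_of_mem hj, hc]), h2]

lemma card_er {S T : Finset ι} {i j : ι} (hi : i ∈ S) (hj : j ∈ T) (hc : S.card = T.card) :
    (S.erase i).card = (T.erase j).card := by
  rw [Finset.card_erase_of_mem hi, Finset.card_erase_of_mem hj, hc]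

lemma stepA {A : ι → ι → Bool} {S T : Finset ι} (hc : S.card = T.card) (hE : Small ι S.card)
    {i : ι} (hi : i ∈ S) (h1 : (row A T i).card ≤ 1) : D A S T < 3 * w ^ 5 ∨ JOne A S T := by
  have hw := w_pos
  interval_cases h : (row A T i).card
  · left
    rw [Finset.card_eq_zero] at h
    rw [D_expand A hi, h]
    simp; positivity
  · rw [Finset.card_eq_one] at h
    obtain ⟨j, hj⟩ := h
    have hjr : j ∈ row A T i := by simp [hj]
    have hjT := (mem_row.1 hjr).1
    have hD := D_expand (T := T) A hi
    have ho := ones_minor A hi hjr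
    rw [hj, Finset.sum_singleton, Finset.card_singleton] at hD
    rw [hj, Finset.card_singleton] at ho
    have hic : i ∈ row (tr A) S j := mem_row.2 ⟨hi, (mem_row.1 hjr).2⟩
    have hpos := Finset.card_pos.2 ⟨i, hic⟩
    have hsm := hE A _ _ (card_er hi hjT hc) (Finset.card_erase_lt_of_mem hi)
    by_cases hcol : (row (tr A) S j).card = 1
    · right
      refine ⟨i, hi, j, hjT, ?_, ?_⟩
      · omega
      · rw [hD, hcol]
    · left
      have : w ^ (1 + (row (tr A) S j).card) ≤ w ^ 3 := wpow_anti (by omega)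
      have h0 := D_nonneg A (S.erase i) (T.erase j)
      rw [hD]
      calc _ ≤ 1 * (3 / 2 * w ^ 3) := by gcongr
        _ < _ := by nlinarith [w5_lo, w3_hi]

def CaseFour (A : ι → ι → Bool) (S T : Finset ι) : Prop :=
  ∃ i ∈ S, ∃ j k, j ≠ k ∧ row A T i = {j, k} ∧ (row (tr A) S j).card = 3 ∧
    (row (tr A) S k).card = 3

lemma stepB' {A : ι → ι → Bool} {S T : Finset ι} (hc : S.card = T.card) (hE : Small ι S.card)
    (hrow : ∀ i ∈ S, 2 ≤ (row A T i).card) (hcol : ∀ j ∈ T, 2 ≤ (row (tr A) S j).card)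
    {i j k : ι} (hi : i ∈ S) (hjk : j ≠ k) (hr : row A T i = {j, k})
    (hcj : (row (tr A) S j).card = 2) :
    D A S T < 3 * w ^ 5 ∨ ∃ R C, R.card = 2 ∧ C.card = 2 ∧ Blk A S T R C := by
  have hw := w_pos
  have hjr : j ∈ row A T i := by simp [hr]
  have hkr : k ∈ row A T i := by simp [hr]
  have hjT := (mem_row.1 hjr).1
  have hkT := (mem_row.1 hkr).1
  have hic : i ∈ row (tr A) S j := mem_row.2 ⟨hi, (mem_row.1 hjr).2⟩
  obtain ⟨l, hl⟩ : ∃ l, (row (tr A) S j).erase i = {l} := by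
    rw [← Finset.card_eq_one, Finset.card_erase_of_mem hic, hcj]
  have hl' : l ∈ (row (tr A) S j).erase i := by simp [hl]
  have hli : l ≠ i := (Finset.mem_erase.1 hl').1
  have hlS : l ∈ S := (mem_row.1 (Finset.mem_erase.1 hl').2).1
  have hlj : A l j = true := (mem_row.1 (Finset.mem_erase.1 hl').2).2
  have hlS' : l ∈ S.erase i := Finset.mem_erase.2 ⟨hli, hlS⟩
  have hkT' : k ∈ T.erase j := Finset.mem_erase.2 ⟨hjk.symm, hkT⟩
  have hcolj : row (tr A) S j = {i, l} := by rw [← hl, Finset.insert_erase hic]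
  have hjl : j ∈ row A T l := mem_row.2 ⟨hjT, hlj⟩
  have hp : pr A S T = pr A (S.erase i) (T.erase j) +
      pr A ((S.erase i).erase l) ((T.erase j).erase k) := by
    rw [pr_expand A hi, hr, Finset.sum_pair hjk]
    congr 1
    rw [← pr_tr, pr_expand (tr A) (Finset.mem_erase.2 ⟨hjk, hjT⟩), row_erase, hl,
      Finset.sum_singleton, pr_tr, Finset.erase_right_comm (s := T)]
  have hr2 : (row A T i).card = 2 := by rw [hr, Finset.card_pair hjk]
  have ho1 := ones_minor A hi hjr
  rw [hr2, hcj] at ho1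
  have hcS : S.card = (S.erase i).card + 1 := (Finset.card_erase_add_one hi).symm
  have hcS2 : (S.erase i).card = ((S.erase i).erase l).card + 1 :=
    (Finset.card_erase_add_one hlS').symm
  have hlt : (S.erase i).card < S.card := by omega
  have hce := card_er hi hjT hc
  have hce2 := card_er hlS' hkT' hce
  by_cases hlk : A l k = true
  · have hkl : k ∈ row A T l := mem_row.2 ⟨hkT, hlk⟩
    have hik : i ∈ row (tr A) S k := mem_row.2 ⟨hi, (mem_row.1 hkr).2⟩
    have hlk' : l ∈ row (tr A) S k := mem_row.2 ⟨hlS, hlk⟩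
    have hrl := hrow l hlS
    have hck := hcol k hkT
    have ho2 := ones_minor A (T := T.erase j) hlS' (j := k)
      (by rw [row_erase]; exact Finset.mem_erase.2 ⟨hjk.symm, hkl⟩)
    rw [row_erase, row_erase, Finset.card_erase_of_mem hjl, Finset.card_erase_of_mem hik] at ho2
    have hones : ones A S T = ones A ((S.erase i).erase l) ((T.erase j).erase k) +
      (row A T l).card + (row (tr A) S k).card := by omega
    have hsub : ({j, k} : Finset ι) ⊆ row A T l := by
      intro x hx; simp only [Finset.mem_insert, Finset.mem_singleton] at hx
      rcases hx with rfl | rfl <;> assumption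
    have hsub2 : ({i, l} : Finset ι) ⊆ row (tr A) S k := by
      intro x hx; simp only [Finset.mem_insert, Finset.mem_singleton] at hx
      rcases hx with rfl | rfl <;> assumption
    have hsm2 := hE A _ _ hce2 (by omega)
    have h02 := D_nonneg A ((S.erase i).erase l) ((T.erase j).erase k)
    by_cases h5 : (row A T l).card + (row (tr A) S k).card ≤ 5
    · by_cases h4 : (row A T l).card + (row (tr A) S k).card = 4
      · right
        refine ⟨{i, l}, {j, k}, Finset.card_pair hli.symm, Finset.card_pair hjk, ?_, ?_, ?_, ?_⟩
        · intro x hx; simp only [Finset.mem_insert, Finset.mem_singleton] at hx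
          rcases hx with rfl | rfl <;> assumption
        · intro x hx; simp only [Finset.mem_insert, Finset.mem_singleton] at hx
          rcases hx with rfl | rfl <;> assumption
        · intro x hx; simp only [Finset.mem_insert, Finset.mem_singleton] at hx
          rcases hx with rfl | rfl
          · exact hr
          · exact (Finset.eq_of_subset_of_card_le hsub (by rw [Finset.card_pair hjk]; omega)).symm
        · intro x hx; simp only [Finset.mem_insert, Finset.mem_singleton] at hx
          rcases hx with rfl | rfl
          · exact hcolj
          · exact (Finset.eq_of_subset_of_card_le hsub2
              (by rw [Finset.card_pair hli.symm]; omega)).symm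
      · left
        have hp2 : pr A (S.erase i) (T.erase j) =
            pr A ((S.erase i).erase l) ((T.erase j).erase k) := by
          by_cases h2 : (row A T l).card = 2
          · have : row A T l = {j, k} :=
              (Finset.eq_of_subset_of_card_le hsub (by rw [Finset.card_pair hjk]; omega)).symm
            rw [pr_expand A hlS', row_erase, this,
              Finset.erase_insert (by simpa using hjk), Finset.sum_singleton]
          · have : row (tr A) S k = {i, l} :=
              (Finset.eq_of_subset_of_card_le hsub2 (by rw [Finset.card_pair hli.symm]; omega)).symm
            rw [← pr_tr, pr_expand (tr A) hkT', row_erase, this,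
              Finset.erase_insert (by simpa using hli.symm), Finset.sum_singleton, pr_tr]
        have hDD : D A S T = D A ((S.erase i).erase l) ((T.erase j).erase k) * w := by
          unfold D
          have : ones A S T = ones A ((S.erase i).erase l) ((T.erase j).erase k) + 5 := by omega
          rw [hp, hp2, hcS, hcS2, this]
          push_cast
          have h7 := w7
          rw [pow_succ, pow_succ, pow_add]
          linear_combination (pr A ((S.erase i).erase l) ((T.erase j).erase k) : ℝ) *
            w ^ ones A ((S.erase i).erase l) ((T.erase j).erase k) *
            (3 / 2 * w) ^ ((S.erase i).erase l).card * (9 / 2) * h7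
        rw [hDD]
        nlinarith [w_hi, w5_lo]
    · left
      push Not at h5
      have hsm1 := hE A _ _ hce hlt
      have h01 := D_nonneg A (S.erase i) (T.erase j)
      have hDD : D A S T = D A (S.erase i) (T.erase j) * (3 / 2 * w ^ 4) +
          D A ((S.erase i).erase l) ((T.erase j).erase k) *
            (w ^ ((row A T l).card + (row (tr A) S k).card) * (9 / 4 * w ^ 2)) := by
        have e1 : w ^ ones A S T = w ^ ones A (S.erase i) (T.erase j) * w ^ 3 := by
          rw [← pow_add]; congr 1; omega
        have e2 : w ^ ones A S T = w ^ ones A ((S.erase i).erase l) ((T.erase j).erase k) *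
            w ^ ((row A T l).card + (row (tr A) S k).card) := by
          rw [← pow_add, ← add_assoc, ← hones]
        have : D A S T = pr A (S.erase i) (T.erase j) * w ^ ones A S T * (3 / 2 * w) ^ S.card +
          pr A ((S.erase i).erase l) ((T.erase j).erase k) * w ^ ones A S T *
            (3 / 2 * w) ^ S.card := by
          unfold D; rw [hp]; push_cast; ring
        rw [this]
        congr 1
        · rw [e1, hcS, D]; ring
        · rw [e2, hcS, hcS2, D]; ring
      have h6 : w ^ ((row A T l).card + (row (tr A) S k).card) ≤ w ^ 6 := wpow_anti h5
      rw [hDD]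
      calc _ ≤ 1 * (3 / 2 * w ^ 4) + 1 * (w ^ 6 * (9 / 4 * w ^ 2)) := by gcongr
        _ < 3 * w ^ 5 := by
          have : w ^ 6 * (9 / 4 * w ^ 2) = 1 / 2 * w ^ 2 := by rw [w6]; ring
          rw [this]
          have : 3 * w ^ 5 - (1 * (3 / 2 * w ^ 4) + 1 * (1 / 2 * w ^ 2)) =
            w ^ 2 * (3 * w ^ 3 - 3 / 2 * w ^ 2 - 1 / 2) := by ring
          have h7 : 0 < w ^ 2 * (3 * w ^ 3 - 3 / 2 * w ^ 2 - 1 / 2) := by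
            apply mul_pos (by positivity)
            linarith [w3_lo, w2_hi]
          linarith
  · left
    let B : ι → ι → Bool := fun a b => if a = l ∧ b = k then true else A a b
    have hBrow : row B (T.erase j) l = insert k (row A (T.erase j) l) := by
      ext x
      simp only [mem_row, Finset.mem_insert, B]
      by_cases hx : x = k
      · subst hx; simp [hkT'] 
      · simp [hx]
    have hknot : k ∉ row A (T.erase j) l := fun h => hlk (mem_row.1 h).2
    have hBpr : pr B (S.erase i) (T.erase j) = pr A S T := by
      rw [hp, pr_expand B hlS', hBrow, Finset.sum_insert hknot, add_comm, pr_expand A hlS']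
      have hcg : ∀ b, pr B ((S.erase i).erase l) ((T.erase j).erase b) =
          pr A ((S.erase i).erase l) ((T.erase j).erase b) := by
        intro b
        refine pr_congr fun x hx y _ => ?_
        have : x ≠ l := (Finset.mem_erase.1 hx).1
        simp [B, this]
      simp only [hcg]
    have hBones : ones A S T = ones B (S.erase i) (T.erase j) + 2 := by
      have h1 : ones B ((S.erase i).erase l) (T.erase j) =
          ones A ((S.erase i).erase l) (T.erase j) := by
        unfold ones
        refine Finset.sum_congr rfl fun x hx => ?_
        have : x ≠ l := (Finset.mem_erase.1 hx).1
        congr 1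
        ext y
        simp [mem_row, B, this]
      have h2 := ones_split B (T := T.erase j) hlS'
      have h3 := ones_split A (T := T.erase j) hlS'
      rw [hBrow, Finset.card_insert_of_notMem hknot, h1] at h2
      omega
    have hDD : D A S T = D B (S.erase i) (T.erase j) * (3 / 2 * w ^ 3) := by
      unfold D
      rw [hBpr, hBones, hcS]
      ring
    have := hE B _ _ hce hlt
    rw [hDD]
    have h3 : 0 < w ^ 3 := by positivity
    nlinarith [w3_hi, w5_lo]

lemma stepB {A : ι → ι → Bool} {S T : Finset ι} (hc : S.card = T.card) (hE : Small ι S.card)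
    (hrow : ∀ i ∈ S, 2 ≤ (row A T i).card) (hcol : ∀ j ∈ T, 2 ≤ (row (tr A) S j).card)
    {i : ι} (hi : i ∈ S) (hr : (row A T i).card = 2) :
    D A S T < 3 * w ^ 5 ∨ (∃ R C, R.card = 2 ∧ C.card = 2 ∧ Blk A S T R C) ∨ CaseFour A S T := by
  obtain ⟨j, k, hjk, hr'⟩ := Finset.card_eq_two.1 hr
  have hjr : j ∈ row A T i := by simp [hr']
  have hkr : k ∈ row A T i := by simp [hr']
  have hjT := (mem_row.1 hjr).1
  have hkT := (mem_row.1 hkr).1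
  have h1 := hcol j hjT
  have h2 := hcol k hkT
  by_cases hj2 : (row (tr A) S j).card = 2
  · rcases stepB' hc hE hrow hcol hi hjk hr' hj2 with h | h
    · exact Or.inl h
    · exact Or.inr (Or.inl h)
  by_cases hk2 : (row (tr A) S k).card = 2
  · rcases stepB' hc hE hrow hcol hi hjk.symm (by rw [hr', Finset.pair_comm]) hk2 with h | h
    · exact Or.inl h
    · exact Or.inr (Or.inl h)
  by_cases h33 : (row (tr A) S j).card = 3 ∧ (row (tr A) S k).card = 3
  · exact Or.inr (Or.inr ⟨i, hi, j, k, hjk, hr', h33.1, h33.2⟩)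
  left
  have hw := w_pos
  rw [D_expand A hi, hr, hr', Finset.sum_pair hjk]
  have hlt := Finset.card_erase_lt_of_mem hi
  have e1 := hE A _ _ (card_er hi hjT hc) hlt
  have e2 := hE A _ _ (card_er hi hkT hc) hlt
  have z1 := D_nonneg A (S.erase i) (T.erase j)
  have z2 := D_nonneg A (S.erase i) (T.erase k)
  have h65 : w ^ 6 < w ^ 5 := by linarith [w6, w5_lo]
  rcases Nat.lt_or_ge 3 (row (tr A) S j).card with h | h
  · have a1 : w ^ (2 + (row (tr A) S j).card) ≤ w ^ 6 := wpow_anti (by omega)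
    have a2 : w ^ (2 + (row (tr A) S k).card) ≤ w ^ 5 := wpow_anti (by omega)
    calc _ ≤ 1 * (3 / 2 * w ^ 6) + 1 * (3 / 2 * w ^ 5) := by gcongr
      _ < _ := by linarith
  · have a1 : w ^ (2 + (row (tr A) S j).card) ≤ w ^ 5 := wpow_anti (by omega)
    have a2 : w ^ (2 + (row (tr A) S k).card) ≤ w ^ 6 := wpow_anti (by omega)
    calc _ ≤ 1 * (3 / 2 * w ^ 5) + 1 * (3 / 2 * w ^ 6) := by gcongr
      _ < _ := by linarith

lemma rw_anti (r : ℕ) (hr : 4 ≤ r) : (r : ℝ) * w ^ (r + 4) ≤ 4 * w ^ 8 := by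
  induction r, hr using Nat.le_induction with
  | base => norm_num
  | succ r hr ih =>
    refine le_trans ?_ ih
    have hw := w_pos
    have h4 : (4 : ℝ) ≤ r := by exact_mod_cast hr
    have : w ^ (r + 1 + 4) = w ^ (r + 4) * w := by ring
    rw [this]
    have hp : 0 < w ^ (r + 4) := by positivity
    push_cast
    have : ((r : ℝ) + 1) * w ≤ r := by nlinarith [w_hi]
    nlinarith

lemma stepC {A : ι → ι → Bool} {S T : Finset ι} (hc : S.card = T.card) (hE : Small ι S.card)
    (hcol : ∀ j ∈ T, 4 ≤ (row (tr A) S j).card)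
    {i : ι} (hi : i ∈ S) (hr : 4 ≤ (row A T i).card) : D A S T < 3 * w ^ 5 := by
  have hw := w_pos
  rw [D_expand A hi]
  calc _ ≤ ∑ j ∈ row A T i, 1 * (3 / 2 * w ^ ((row A T i).card + 4)) := by
        refine Finset.sum_le_sum fun j hj => ?_
        have hjT := (mem_row.1 hj).1
        have e1 := hE A _ _ (card_er hi hjT hc) (Finset.card_erase_lt_of_mem hi)
        have a1 : w ^ ((row A T i).card + (row (tr A) S j).card) ≤ w ^ ((row A T i).card + 4) :=
          wpow_anti (by have := hcol j hjT; omega)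
        gcongr
    _ = 3 / 2 * ((row A T i).card * w ^ ((row A T i).card + 4)) := by
        rw [Finset.sum_const, nsmul_eq_mul]; ring
    _ ≤ 3 / 2 * (4 * w ^ 8) := mul_le_mul_of_nonneg_left (rw_anti _ hr) (by norm_num)
    _ < _ := by rw [w8]; linarith [w2_hi, w5_lo]

def CaseFive (A : ι → ι → Bool) (S T : Finset ι) : Prop :=
  (∀ i ∈ S, 3 ≤ (row A T i).card) ∧ (∀ j ∈ T, 3 ≤ (row (tr A) S j).card) ∧
  ∃ i ∈ S, (row A T i).card = 3

lemma step {A : ι → ι → Bool} {S T : Finset ι} (hc : S.card = T.card) (hE : Small ι S.card)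
    (hne : S.Nonempty) : D A S T < 3 * w ^ 5 ∨ JOne A S T ∨
      (∃ R C, R.card = 2 ∧ C.card = 2 ∧ Blk A S T R C) ∨
      (((∀ i ∈ S, 2 ≤ (row A T i).card) ∧ (∀ j ∈ T, 2 ≤ (row (tr A) S j).card)) ∧
        (CaseFour A S T ∨ CaseFour (tr A) T S)) ∨
      (CaseFive A S T ∨ CaseFive (tr A) T S) := by
  have hE' : Small ι T.card := hc ▸ hE
  by_cases a1 : ∃ i ∈ S, (row A T i).card ≤ 1
  · obtain ⟨i, hi, h⟩ := a1
    have := stepA hc hE hi h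
    tauto
  by_cases a2 : ∃ i ∈ T, (row (tr A) S i).card ≤ 1
  · obtain ⟨i, hi, h⟩ := a2
    rcases stepA hc.symm hE' hi h with h | h
    · rw [D_tr _ hc] at h; exact Or.inl h
    · exact Or.inr (Or.inl (h.tr hc.symm))
  push Not at a1 a2
  have b1 : ∀ i ∈ S, 2 ≤ (row A T i).card := fun i hi => a1 i hi
  have b2 : ∀ i ∈ T, 2 ≤ (row (tr A) S i).card := fun i hi => a2 i hi
  by_cases a3 : ∃ i ∈ S, (row A T i).card = 2
  · obtain ⟨i, hi, h⟩ := a3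
    rcases stepB hc hE b1 b2 hi h with h | h | h
    · exact Or.inl h
    · exact Or.inr (Or.inr (Or.inl h))
    · exact Or.inr (Or.inr (Or.inr (Or.inl ⟨⟨b1, b2⟩, Or.inl h⟩)))
  by_cases a4 : ∃ i ∈ T, (row (tr A) S i).card = 2
  · obtain ⟨i, hi, h⟩ := a4
    rcases stepB hc.symm hE' b2 b1 hi h with h | ⟨R, C, h1, h2, h3⟩ | h
    · rw [D_tr _ hc] at h; exact Or.inl h
    · exact Or.inr (Or.inr (Or.inl ⟨C, R, h2, h1, h3.tr⟩))
    · exact Or.inr (Or.inr (Or.inr (Or.inl ⟨⟨b1, b2⟩, Or.inr h⟩)))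
  push Not at a3 a4
  have c1 : ∀ i ∈ S, 3 ≤ (row A T i).card := fun i hi => by
    have := b1 i hi; have := a3 i hi; omega
  have c2 : ∀ i ∈ T, 3 ≤ (row (tr A) S i).card := fun i hi => by
    have := b2 i hi; have := a4 i hi; omega
  by_cases a5 : ∃ i ∈ S, (row A T i).card = 3
  · exact Or.inr (Or.inr (Or.inr (Or.inr (Or.inl ⟨c1, c2, a5⟩))))
  by_cases a6 : ∃ i ∈ T, (row (tr A) S i).card = 3
  · exact Or.inr (Or.inr (Or.inr (Or.inr (Or.inr ⟨c2, c1, a6⟩))))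
  push Not at a5 a6
  obtain ⟨i, hi⟩ := hne
  left
  refine stepC hc hE (fun j hj => ?_) hi ?_
  · have := c2 j hj; have := a6 j hj; omega
  · have := c1 i hi; have := a5 i hi; omega

end Comb2
end BGM

namespace BGM
section Comb3
set_option linter.unusedSectionVars false
variable {ι : Type} [DecidableEq ι]

structure IsJ (A : ι → ι → Bool) (S T : Finset ι) : Prop where
  rows : ∀ i ∈ S, (row A T i).card = 2 ∨ (row A T i).card = 3
  cols : ∀ j ∈ T, (row (tr A) S j).card = 2 ∨ (row (tr A) S j).card = 3
  eq : ∀ i ∈ S, ∀ j ∈ T, A i j = true → (row A T i).card = (row (tr A) S j).card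
  rect : ∀ i ∈ S, ∀ i' ∈ S, ∀ j ∈ T, ∀ j' ∈ T, A i j = true → A i' j = true → A i j' = true →
    A i' j' = true

lemma IsJ.tr {A : ι → ι → Bool} {S T : Finset ι} (h : IsJ A S T) : IsJ (tr A) T S :=
  ⟨h.cols, h.rows, fun j hj i hi hA => (h.eq i hi j hj hA).symm,
    fun j hj j' hj' i hi i' hi' h1 h2 h3 => h.rect i hi i' hi' j hj j' hj' h1 h3 h2⟩

lemma Blk.mem_iff {A : ι → ι → Bool} {S T R C : Finset ι} (h : Blk A S T R C) {i j : ι}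
    (hi : i ∈ S) (hj : j ∈ T) (hA : A i j = true) : i ∈ R ↔ j ∈ C := by
  constructor
  · intro hR
    rw [← h.row_eq i hR]
    exact mem_row.2 ⟨hj, hA⟩
  · intro hC
    rw [← h.col_eq j hC]
    exact mem_row.2 ⟨hi, hA⟩

lemma Blk.full {A : ι → ι → Bool} {S T R C : Finset ι} (h : Blk A S T R C) {i j : ι}
    (hi : i ∈ R) (hj : j ∈ C) : A i j = true := by
  rw [← h.row_eq i hi] at hj
  exact (mem_row.1 hj).2

lemma Blk.row_sdiff {A : ι → ι → Bool} {S T R C : Finset ι} (h : Blk A S T R C) {i : ι}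
    (hi : i ∈ S) (hR : i ∉ R) : row A (T \ C) i = row A T i := by
  ext j
  simp only [mem_row, Finset.mem_sdiff]
  constructor
  · tauto
  · rintro ⟨hj, hA⟩
    have := h.mem_iff hi hj hA
    tauto

lemma Blk.ones {A : ι → ι → Bool} {S T R C : Finset ι} (h : Blk A S T R C) :
    ones A S T = ones A (S \ R) (T \ C) + R.card * C.card := by
  unfold BGM.ones
  rw [← Finset.sum_sdiff h.rs]
  congr 1
  · refine Finset.sum_congr rfl fun i hi => ?_
    rw [Finset.mem_sdiff] at hi
    rw [h.row_sdiff hi.1 hi.2]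
  · rw [Finset.sum_congr rfl (fun i hi => by rw [h.row_eq i hi]), Finset.sum_const, smul_eq_mul]

lemma isJ_blk {A : ι → ι → Bool} {S T R C : Finset ι} (h : Blk A S T R C) (hRC : R.card = C.card)
    (h23 : R.card = 2 ∨ R.card = 3) : IsJ A (S \ R) (T \ C) ↔ IsJ A S T := by
  have hr : ∀ i ∈ S, i ∉ R → row A (T \ C) i = row A T i := fun i hi hR => h.row_sdiff hi hR
  have hcl : ∀ j ∈ T, j ∉ C → row (BGM.tr A) (S \ R) j = row (BGM.tr A) S j :=
    fun i hi hR => h.tr.row_sdiff hi hR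
  constructor
  · intro hJ
    refine ⟨?_, ?_, ?_, ?_⟩
    · intro i hi
      by_cases hR : i ∈ R
      · rw [h.row_eq i hR, ← hRC]; exact h23
      · rw [← hr i hi hR]; exact hJ.rows i (Finset.mem_sdiff.2 ⟨hi, hR⟩)
    · intro j hj
      by_cases hC : j ∈ C
      · rw [h.col_eq j hC]; exact h23
      · rw [← hcl j hj hC]; exact hJ.cols j (Finset.mem_sdiff.2 ⟨hj, hC⟩)
    · intro i hi j hj hA
      have hm := h.mem_iff hi hj hA
      by_cases hR : i ∈ R
      · rw [h.row_eq i hR, h.col_eq j (hm.1 hR), hRC]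
      · have hC : j ∉ C := fun hC => hR (hm.2 hC)
        rw [← hr i hi hR, ← hcl j hj hC]
        exact hJ.eq i (Finset.mem_sdiff.2 ⟨hi, hR⟩) j (Finset.mem_sdiff.2 ⟨hj, hC⟩) hA
    · intro i hi i' hi' j hj j' hj' h1 h2 h3
      have m1 := h.mem_iff hi hj h1
      have m2 := h.mem_iff hi' hj h2
      have m3 := h.mem_iff hi hj' h3
      by_cases hR : i ∈ R
      · exact h.full (m2.2 (m1.1 hR)) (m3.1 hR)
      · exact hJ.rect i (Finset.mem_sdiff.2 ⟨hi, hR⟩) i' (Finset.mem_sdiff.2 ⟨hi', by tauto⟩)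
          j (Finset.mem_sdiff.2 ⟨hj, by tauto⟩) j' (Finset.mem_sdiff.2 ⟨hj', by tauto⟩) h1 h2 h3
  · intro hJ
    refine ⟨?_, ?_, ?_, ?_⟩
    · intro i hi
      rw [Finset.mem_sdiff] at hi
      rw [hr i hi.1 hi.2]; exact hJ.rows i hi.1
    · intro j hj
      rw [Finset.mem_sdiff] at hj
      rw [hcl j hj.1 hj.2]; exact hJ.cols j hj.1
    · intro i hi j hj hA
      rw [Finset.mem_sdiff] at hi hj
      rw [hr i hi.1 hi.2, hcl j hj.1 hj.2]; exact hJ.eq i hi.1 j hj.1 hA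
    · intro i hi i' hi' j hj j' hj' h1 h2 h3
      rw [Finset.mem_sdiff] at hi hj hi' hj'
      exact hJ.rect i hi.1 i' hi'.1 j hj.1 j' hj'.1 h1 h2 h3

lemma Blk.D_two {A : ι → ι → Bool} {S T R C : Finset ι} (h : Blk A S T R C)
    (hR : R.card = 2) (hC : C.card = 2) : D A S T = D A (S \ R) (T \ C) := by
  have hones := h.ones
  obtain ⟨i, l, hil, rfl⟩ := Finset.card_eq_two.1 hR
  obtain ⟨j, k, hjk, rfl⟩ := Finset.card_eq_two.1 hC
  have hi : i ∈ S := h.rs (by simp)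
  have hl : l ∈ S := h.rs (by simp)
  have hli' : l ∈ S.erase i := Finset.mem_erase.2 ⟨hil.symm, hl⟩
  have e1 : ∀ (U : Finset ι) (a b : ι), U \ {a, b} = (U.erase a).erase b := by
    intro U a b; ext x; simp; tauto
  have hp : pr A S T = 2 * pr A (S \ {i, l}) (T \ {j, k}) := by
    rw [pr_expand A hi, h.row_eq i (by simp), Finset.sum_pair hjk,
      pr_expand A hli', pr_expand A hli', row_erase, row_erase, h.row_eq l (by simp),
      Finset.erase_insert (by simpa using hjk), Finset.sum_singleton, Finset.pair_comm,
      Finset.erase_insert (by simpa using hjk.symm), Finset.sum_singleton, e1, e1,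
      Finset.erase_right_comm (s := T)]
    ring
  have hcard : S.card = (S \ {i, l}).card + 2 := by
    rw [← Finset.card_sdiff_add_card_eq_card h.rs, hR]
  rw [hR, hC] at hones
  unfold D
  rw [hp, hones, hcard]
  push_cast
  have h6 := w6
  rw [pow_add, pow_add]
  linear_combination (pr A (S \ {i, l}) (T \ {j, k}) : ℝ) *
    w ^ BGM.ones A (S \ {i, l}) (T \ {j, k}) * (3 / 2 * w) ^ (S \ {i, l}).card * (9 / 2) * h6

lemma IsJ.toBlk {A : ι → ι → Bool} {S T : Finset ι} (h : IsJ A S T) {i : ι} (hi : i ∈ S) :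
    ∃ R, i ∈ R ∧ R.card = (row A T i).card ∧ Blk A S T R (row A T i) := by
  have : (row A T i).Nonempty := by
    rw [← Finset.card_pos]; rcases h.rows i hi with h | h <;> omega
  obtain ⟨j, hj⟩ := this
  obtain ⟨hjT, hA⟩ := mem_row.1 hj
  refine ⟨row (BGM.tr A) S j, mem_row.2 ⟨hi, hA⟩, (h.eq i hi j hjT hA).symm, ?_, ?_, ?_, ?_⟩
  · exact Finset.filter_subset _ _
  · exact Finset.filter_subset _ _
  · intro l hl
    obtain ⟨hlS, hlj⟩ := mem_row.1 hl
    ext x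
    simp only [mem_row]
    exact and_congr_right fun hx => ⟨fun q => h.rect l hlS i hi j hjT x hx hlj hA q,
      fun q => h.rect i hi l hlS j hjT x hx hA hlj q⟩
  · intro k hk
    obtain ⟨hkT, hAk⟩ := mem_row.1 hk
    ext x
    simp only [mem_row]
    exact and_congr_right fun hx => ⟨fun q => h.rect i hi x hx k hkT j hjT hAk q hA,
      fun q => h.rect i hi x hx j hjT k hkT hA q hAk⟩

lemma sdiff_erase_erase {S R : Finset ι} {i : ι} (hi : i ∈ R) :
    (S.erase i) \ (R.erase i) = S \ R := by
  ext x
  simp only [Finset.mem_sdiff, Finset.mem_erase]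
  constructor
  · tauto
  · rintro ⟨h1, h2⟩
    refine ⟨⟨?_, h1⟩, by tauto⟩
    rintro rfl; exact h2 hi

lemma Blk.minor {A : ι → ι → Bool} {S T R C : Finset ι} (h : Blk A S T R C) {i j : ι} :
    Blk A (S.erase i) (T.erase j) (R.erase i) (C.erase j) := by
  refine ⟨Finset.erase_subset_erase _ h.rs, Finset.erase_subset_erase _ h.ct, ?_, ?_⟩
  · intro l hl
    rw [row_erase, h.row_eq l (Finset.mem_of_mem_erase hl)]
  · intro l hl
    rw [row_erase, h.col_eq l (Finset.mem_of_mem_erase hl)]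

lemma D_empty (A : ι → ι → Bool) : D A ∅ ∅ = 1 := by
  unfold D; rw [pr_empty]; simp [ones]

lemma IsJ.D_eq {A : ι → ι → Bool} : ∀ (N : ℕ) {S T : Finset ι}, S.card = N → T.card = N →
    IsJ A S T → D A S T = 1 := by
  intro N
  induction N using Nat.strong_induction_on with
  | _ N ih =>
    intro S T hS hT h
    rcases S.eq_empty_or_nonempty with rfl | ⟨i, hi⟩
    · have : T = ∅ := by rw [← Finset.card_eq_zero, hT, ← hS]; rfl
      subst this
      exact D_empty A
    · obtain ⟨R, hiR, hRc, hB⟩ := h.toBlk hi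
      have h23 := h.rows i hi
      have hJ' := (isJ_blk hB hRc (by rw [hRc]; exact h23)).2 h
      have c1 := Finset.card_sdiff_add_card_eq_card hB.rs
      have c2 := Finset.card_sdiff_add_card_eq_card hB.ct
      rcases h23 with h2 | h3
      · rw [hB.D_two (by rw [hRc, h2]) h2]
        exact ih (S \ R).card (by omega) rfl (by omega) hJ'
      · rw [D_expand A hi, h3]
        have : ∀ j ∈ row A T i, D A (S.erase i) (T.erase j) *
            (3 / 2 * w ^ (3 + (row (BGM.tr A) S j).card)) = 1 / 3 := by
          intro j hj
          have hjT := (mem_row.1 hj).1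
          rw [hB.col_eq j hj, hRc, h3, w6]
          have hm := hB.minor (i := i) (j := j)
          have hs := Finset.card_erase_of_mem hiR
          have hs' := Finset.card_erase_of_mem hj
          have hs2 := Finset.card_erase_of_mem hi
          have hs3 := Finset.card_erase_of_mem hjT
          have hSp := Finset.card_pos.2 ⟨i, hi⟩
          have : IsJ A (S.erase i) (T.erase j) := by
            rw [← isJ_blk hm (by omega) (by omega), sdiff_erase_erase hiR, sdiff_erase_erase hj]
            exact hJ'
          rw [ih (N - 1) (by omega) (by omega) (by omega) this]
          norm_num
        rw [Finset.sum_congr rfl this, Finset.sum_const, h3]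
        norm_num

/-- `A₃` plus `J₂`s and `J₃`s -/
def IsN (A : ι → ι → Bool) (S T : Finset ι) : Prop :=
  ∃ (R C : Finset ι) (i k : ι), R ⊆ S ∧ C ⊆ T ∧ R.card = 3 ∧ C.card = 3 ∧ i ∈ R ∧ k ∈ C ∧
    (row A T i = C.erase k) ∧ (∀ l ∈ R, l ≠ i → row A T l = C) ∧
    (row (tr A) S k = R.erase i) ∧ (∀ l ∈ C, l ≠ k → row (tr A) S l = R) ∧
    IsJ A (S \ R) (T \ C)

lemma IsN.tr {A : ι → ι → Bool} {S T : Finset ι} (h : IsN A S T) : IsN (tr A) T S := by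
  obtain ⟨R, C, i, k, h1, h2, h3, h4, h5, h6, h7, h8, h9, h10, h11⟩ := h
  exact ⟨C, R, k, i, h2, h1, h4, h3, h6, h5, h9, h10, h7, h8, h11.tr⟩

lemma IsN.D_eq {A : ι → ι → Bool} {S T : Finset ι} (hc : S.card = T.card)
    (h : IsN A S T) : D A S T = 3 * w ^ 5 := by
  obtain ⟨R, C, i, k, h1, h2, h3, h4, h5, h6, h7, h8, h9, h10, h11⟩ := h
  have hi := h1 h5
  have hck := Finset.card_erase_of_mem h6
  have hci := Finset.card_erase_of_mem h5
  rw [D_expand A hi, h7]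
  have : ∀ j ∈ C.erase k, D A (S.erase i) (T.erase j) *
      (3 / 2 * w ^ ((C.erase k).card + (row (BGM.tr A) S j).card)) = 3 / 2 * w ^ 5 := by
    intro j hj
    obtain ⟨hjk, hjC⟩ := Finset.mem_erase.1 hj
    have hjT := h2 hjC
    rw [h10 j hjC hjk, hck, h3, h4]
    have hm : Blk A (S.erase i) (T.erase j) (R.erase i) (C.erase j) := by
      refine ⟨Finset.erase_subset_erase _ h1, Finset.erase_subset_erase _ h2, ?_, ?_⟩
      · intro l hl
        rw [row_erase, h8 l (Finset.mem_of_mem_erase hl) (Finset.ne_of_mem_erase hl)]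
      · intro x hx
        rw [row_erase]
        by_cases hxk : x = k
        · subst hxk; rw [h9]; simp
        · rw [h10 x (Finset.mem_of_mem_erase hx) hxk]
    have hs' := Finset.card_erase_of_mem hjC
    have : IsJ A (S.erase i) (T.erase j) := by
      rw [← isJ_blk hm (by omega) (by omega), sdiff_erase_erase h5, sdiff_erase_erase hjC]
      exact h11
    rw [this.D_eq _ rfl (card_er hi hjT hc).symm, one_mul]
  rw [Finset.sum_congr rfl this, Finset.sum_const, hck, h4]
  norm_num
  ring

lemma IsN.col_le {A : ι → ι → Bool} {S T : Finset ι} (h : IsN A S T) {j : ι} (hj : j ∈ T) :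
    (row (BGM.tr A) S j).card ≤ 3 := by
  obtain ⟨R, C, i, k, h1, h2, h3, h4, h5, h6, h7, h8, h9, h10, h11⟩ := h
  by_cases hjC : j ∈ C
  · by_cases hjk : j = k
    · subst hjk; rw [h9, Finset.card_erase_of_mem h5]; omega
    · rw [h10 j hjC hjk, h3]
  · have : row (BGM.tr A) (S \ R) j = row (BGM.tr A) S j := by
      ext x
      simp only [mem_row, Finset.mem_sdiff]
      constructor
      · tauto
      · rintro ⟨hx, hA⟩
        refine ⟨⟨hx, fun hxR => hjC ?_⟩, hA⟩
        have hjr : j ∈ row A T x := mem_row.2 ⟨hj, hA⟩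
        by_cases hxi : x = i
        · subst hxi; rw [h7] at hjr; exact Finset.mem_of_mem_erase hjr
        · rw [h8 x hxR hxi] at hjr; exact hjr
    rw [← this]
    rcases h11.cols j (Finset.mem_sdiff.2 ⟨hj, hjC⟩) with h | h <;> omega

lemma isN_blk {A : ι → ι → Bool} {S T R C : Finset ι} (h : Blk A S T R C) (hR : R.card = 2)
    (hC : C.card = 2) (hN : IsN A (S \ R) (T \ C)) : IsN A S T := by
  obtain ⟨R', C', i, k, h1, h2, h3, h4, h5, h6, h7, h8, h9, h10, h11⟩ := hN
  have hr : ∀ i ∈ R', row A (T \ C) i = row A T i := fun i hi =>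
    h.row_sdiff (Finset.mem_sdiff.1 (h1 hi)).1 (Finset.mem_sdiff.1 (h1 hi)).2
  have hcl : ∀ j ∈ C', row (BGM.tr A) (S \ R) j = row (BGM.tr A) S j := fun i hi =>
    h.tr.row_sdiff (Finset.mem_sdiff.1 (h2 hi)).1 (Finset.mem_sdiff.1 (h2 hi)).2
  have q1 : ∀ x ∈ R, x ∉ R' := fun x hx hx' => (Finset.mem_sdiff.1 (h1 hx')).2 hx
  have q2 : ∀ x ∈ C, x ∉ C' := fun x hx hx' => (Finset.mem_sdiff.1 (h2 hx')).2 hx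
  refine ⟨R', C', i, k, fun x hx => (Finset.mem_sdiff.1 (h1 hx)).1,
    fun x hx => (Finset.mem_sdiff.1 (h2 hx)).1, h3, h4, h5, h6, by rw [← hr i h5, h7],
    fun l hl hli => by rw [← hr l hl, h8 l hl hli], by rw [← hcl k h6, h9],
    fun l hl hli => by rw [← hcl l hl, h10 l hl hli], ?_⟩
  have hB : Blk A (S \ R') (T \ C') R C := by
    refine ⟨fun x hx => Finset.mem_sdiff.2 ⟨h.rs hx, q1 x hx⟩,
      fun x hx => Finset.mem_sdiff.2 ⟨h.ct hx, q2 x hx⟩, ?_, ?_⟩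
    · intro x hx
      rw [← h.row_eq x hx]
      ext y
      simp only [mem_row, Finset.mem_sdiff]
      constructor
      · tauto
      · rintro ⟨hy, hA⟩
        exact ⟨⟨hy, q2 y ((h.mem_iff (h.rs hx) hy hA).1 hx)⟩, hA⟩
    · intro x hx
      rw [← h.col_eq x hx]
      ext y
      simp only [mem_row, Finset.mem_sdiff]
      constructor
      · tauto
      · rintro ⟨hy, hA⟩
        exact ⟨⟨hy, q1 y ((h.mem_iff hy (h.ct hx) hA).2 hx)⟩, hA⟩
  rw [← isJ_blk hB (by omega) (by omega), sdiff_right_comm,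
    show (T \ C') \ C = (T \ C) \ C' by ext; simp only [Finset.mem_sdiff]; tauto]
  exact h11

/-- equality analysis in case five for the basic bound -/
lemma five_isJ {A : ι → ι → Bool} {S T : Finset ι}
    (hrow : ∀ i ∈ S, 3 ≤ (row A T i).card) {i : ι} (hi : i ∈ S) (hr : (row A T i).card = 3)
    (hc3 : ∀ j ∈ row A T i, (row (tr A) S j).card = 3)
    (hJ : ∀ j ∈ row A T i, IsJ A (S.erase i) (T.erase j)) : IsJ A S T := by
  have hic : ∀ j ∈ row A T i, i ∈ row (tr A) S j := fun j hj => mem_row.2 ⟨hi, (mem_row.1 hj).2⟩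
  have key : ∀ j ∈ row A T i, ∀ j2 ∈ row A T i, j2 ≠ j → ∀ l ∈ row (tr A) S j2, l ≠ i →
      j ∈ row A T l ∧ (row A T l).card = 3 := by
    intro j hj j2 hj2 hne l hl hli
    obtain ⟨hlS, hA⟩ := mem_row.1 hl
    have := (hJ j hj).eq l (Finset.mem_erase.2 ⟨hli, hlS⟩) j2
      (Finset.mem_erase.2 ⟨hne, (mem_row.1 hj2).1⟩) hA
    rw [row_erase, row_erase, Finset.card_erase_of_mem (hic j2 hj2), hc3 j2 hj2] at this
    have h3 := hrow l hlS
    by_cases hjl : j ∈ row A T l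
    · rw [Finset.card_erase_of_mem hjl] at this
      exact ⟨hjl, by omega⟩
    · rw [Finset.erase_eq_of_notMem hjl] at this
      omega
  have hcols : ∀ j ∈ row A T i, ∀ j2 ∈ row A T i, row (tr A) S j2 = row (tr A) S j := by
    intro j hj j2 hj2
    by_cases hne : j2 = j
    · rw [hne]
    refine Finset.eq_of_subset_of_card_le ?_ (by rw [hc3 j hj, hc3 j2 hj2])
    intro l hl
    by_cases hli : l = i
    · subst hli; exact hic j hj
    · exact mem_row.2 ⟨(mem_row.1 hl).1, (mem_row.1 (key j hj j2 hj2 hne l hl hli).1).2⟩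
  obtain ⟨j1, hj1⟩ : (row A T i).Nonempty := by rw [← Finset.card_pos]; omega
  obtain ⟨j2, hj2, hne⟩ := Finset.exists_mem_ne (by omega : 1 < (row A T i).card) j1
  have hB : Blk A S T (row (tr A) S j1) (row A T i) := by
    refine ⟨Finset.filter_subset _ _, Finset.filter_subset _ _, ?_, fun j hj => hcols j1 hj1 j hj⟩
    intro l hl
    by_cases hli : l = i
    · rw [hli]
    symm
    refine Finset.eq_of_subset_of_card_le ?_ ?_
    · intro x hx
      rw [← hcols j1 hj1 x hx] at hl
      exact mem_row.2 ⟨(mem_row.1 hx).1, (mem_row.1 hl).2⟩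
    · rw [← hcols j1 hj1 j2 hj2] at hl
      rw [(key j1 hj1 j2 hj2 hne l hl hli).2, hr]
  have hm := hB.minor (i := i) (j := j1)
  have e1 := Finset.card_erase_of_mem (hic j1 hj1)
  have e2 := Finset.card_erase_of_mem hj1
  have e3 := hc3 j1 hj1
  rw [← isJ_blk hB (by omega) (by omega), ← sdiff_erase_erase (hic j1 hj1), ← sdiff_erase_erase hj1,
    isJ_blk hm (by omega) (by omega)]
  exact hJ j1 hj1

lemma four_isN {A : ι → ι → Bool} {S T : Finset ι} {i j k : ι} (hi : i ∈ S) (hjk : j ≠ k)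
    (hr : row A T i = {j, k}) (hj3 : (row (tr A) S j).card = 3) (hk3 : (row (tr A) S k).card = 3)
    (hJj : IsJ A (S.erase i) (T.erase j)) (hJk : IsJ A (S.erase i) (T.erase k)) : IsN A S T := by
  have hjr : j ∈ row A T i := by simp [hr]
  have hkr : k ∈ row A T i := by simp [hr]
  have hjT := (mem_row.1 hjr).1
  have hkT := (mem_row.1 hkr).1
  have hij : i ∈ row (tr A) S j := mem_row.2 ⟨hi, (mem_row.1 hjr).2⟩
  have hik : i ∈ row (tr A) S k := mem_row.2 ⟨hi, (mem_row.1 hkr).2⟩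
  have hkT' : k ∈ T.erase j := Finset.mem_erase.2 ⟨hjk.symm, hkT⟩
  have key : ∀ l ∈ row (tr A) S k, l ≠ i → j ∈ row A T l ∧ (row A T l).card = 3 := by
    intro l hl hli
    obtain ⟨hlS, hA⟩ := mem_row.1 hl
    have hlS' : l ∈ S.erase i := Finset.mem_erase.2 ⟨hli, hlS⟩
    have := hJj.eq l hlS' k hkT' hA
    rw [row_erase, row_erase, Finset.card_erase_of_mem hik, hk3] at this
    by_cases hjl : j ∈ row A T l
    · rw [Finset.card_erase_of_mem hjl] at this
      exact ⟨hjl, by omega⟩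
    · rw [Finset.erase_eq_of_notMem hjl] at this
      have h2 := hJk.rows l hlS'
      rw [row_erase, Finset.card_erase_of_mem (mem_row.2 ⟨hkT, hA⟩)] at h2
      omega
  have hcols : row (tr A) S k = row (tr A) S j := by
    refine Finset.eq_of_subset_of_card_le ?_ (by omega)
    intro l hl
    by_cases hli : l = i
    · subst hli; exact hij
    · exact mem_row.2 ⟨(mem_row.1 hl).1, (mem_row.1 (key l hl hli).1).2⟩
  obtain ⟨l, hl, hli⟩ := Finset.exists_mem_ne (by omega : 1 < (row (tr A) S k).card) i
  obtain ⟨hlS, hlk⟩ := mem_row.1 hl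
  have hlS' : l ∈ S.erase i := Finset.mem_erase.2 ⟨hli, hlS⟩
  obtain ⟨hlj, hl3⟩ := key l hl hli
  have hrows : ∀ m ∈ row (tr A) S k, m ≠ i → row A T m = row A T l := by
    intro m hm hmi
    obtain ⟨hmj, hm3⟩ := key m hm hmi
    symm
    refine Finset.eq_of_subset_of_card_le ?_ (by omega)
    intro x hx
    by_cases hxj : x = j
    · subst hxj; exact hmj
    obtain ⟨hxT, hlx⟩ := mem_row.1 hx
    exact mem_row.2 ⟨hxT, hJj.rect l hlS' m (Finset.mem_erase.2 ⟨hmi, (mem_row.1 hm).1⟩) k hkT'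
      x (Finset.mem_erase.2 ⟨hxj, hxT⟩) hlk (mem_row.1 hm).2 hlx⟩
  have hjkl : ({j, k} : Finset ι) ⊆ row A T l := by
    intro x hx; simp only [Finset.mem_insert, Finset.mem_singleton] at hx
    rcases hx with rfl | rfl
    · exact hlj
    · exact mem_row.2 ⟨hkT, hlk⟩
  obtain ⟨k', hk'l, hk'⟩ := Finset.exists_mem_notMem_of_card_lt_card
    (by rw [Finset.card_pair hjk]; omega : ({j, k} : Finset ι).card < (row A T l).card)
  have hk'j : k' ≠ j := by rintro rfl; simp at hk'
  have hk'k : k' ≠ k := by rintro rfl; simp at hk'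
  have hrowi : row A T i = (row A T l).erase k' := by
    rw [hr]
    refine Finset.eq_of_subset_of_card_le ?_ ?_
    · intro x hx
      exact Finset.mem_erase.2 ⟨fun h => hk' (h ▸ hx), hjkl hx⟩
    · rw [Finset.card_erase_of_mem hk'l, Finset.card_pair hjk]; omega
  have hk'T := (mem_row.1 hk'l).1
  have hik' : i ∉ row (tr A) S k' := by
    intro h
    apply hk'
    rw [← hr]
    exact mem_row.2 ⟨hk'T, (mem_row.1 h).2⟩
  have hcolk' : row (tr A) S k' = (row (tr A) S k).erase i := by
    symm
    refine Finset.eq_of_subset_of_card_le ?_ ?_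
    · intro m hm
      obtain ⟨hmi, hm⟩ := Finset.mem_erase.1 hm
      rw [← hrows m hm hmi] at hk'l
      exact mem_row.2 ⟨(mem_row.1 hm).1, (mem_row.1 hk'l).2⟩
    · rw [Finset.card_erase_of_mem hik, hk3]
      have := hJj.eq l hlS' k' (Finset.mem_erase.2 ⟨hk'j, hk'T⟩) (mem_row.1 hk'l).2
      rw [row_erase, row_erase, Finset.erase_eq_of_notMem hik', Finset.card_erase_of_mem hlj] at this
      omega
  have hcolC : ∀ x ∈ row A T l, x ≠ k' → row (tr A) S x = row (tr A) S k := by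
    intro x hx hxk
    have : x ∈ row A T i := by rw [hrowi]; exact Finset.mem_erase.2 ⟨hxk, hx⟩
    rw [hr] at this
    simp only [Finset.mem_insert, Finset.mem_singleton] at this
    rcases this with rfl | rfl
    · exact hcols.symm
    · rfl
  refine ⟨row (tr A) S k, row A T l, i, k', Finset.filter_subset _ _, Finset.filter_subset _ _,
    hk3, hl3, hik, hk'l, hrowi, hrows, hcolk', hcolC, ?_⟩
  have hm : Blk A (S.erase i) (T.erase j) ((row (tr A) S k).erase i) ((row A T l).erase j) := by
    refine ⟨Finset.erase_subset_erase _ (Finset.filter_subset _ _),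
      Finset.erase_subset_erase _ (Finset.filter_subset _ _), ?_, ?_⟩
    · intro x hx
      obtain ⟨h1, h2⟩ := Finset.mem_erase.1 hx
      rw [row_erase, hrows x h2 h1]
    · intro x hx
      obtain ⟨h1, h2⟩ := Finset.mem_erase.1 hx
      rw [row_erase]
      by_cases hxk : x = k'
      · subst hxk; rw [hcolk']; simp
      · rw [hcolC x h2 hxk]
  have e1 := Finset.card_erase_of_mem hik
  have e2 := Finset.card_erase_of_mem hlj
  rw [← sdiff_erase_erase hik, ← sdiff_erase_erase hlj, isJ_blk hm (by omega) (by omega)]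
  exact hJj

/-- basic bound with equality -/
theorem main_E : ∀ (N : ℕ) (A : ι → ι → Bool) (S T : Finset ι), S.card = N → T.card = N →
    D A S T ≤ 1 ∧ (D A S T = 1 → IsJ A S T) := by
  intro N
  induction N using Nat.strong_induction_on with
  | _ N ih =>
    intro A S T hS hT
    have hw := w_pos
    have hc : S.card = T.card := by omega
    have hE : Small ι S.card := fun B S' T' h1 h2 => (ih S'.card (by omega) B S' T' rfl h1.symm).1
    have five : ∀ (A : ι → ι → Bool) (S T : Finset ι), S.card = N → T.card = N →
        CaseFive A S T → D A S T ≤ 1 ∧ (D A S T = 1 → IsJ A S T) := by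
      rintro A S T hS hT ⟨hr, hcl, i, hi, hi3⟩
      have hSp := Finset.card_pos.2 ⟨i, hi⟩
      have hse := Finset.card_erase_of_mem hi
      have hsm : ∀ j ∈ row A T i, D A (S.erase i) (T.erase j) ≤ 1 ∧
          (D A (S.erase i) (T.erase j) = 1 → IsJ A (S.erase i) (T.erase j)) := by
        intro j hj
        exact ih (N - 1) (by omega) A _ _ (by omega)
          (by rw [Finset.card_erase_of_mem (mem_row.1 hj).1]; omega)
      have hterm : ∀ j ∈ row A T i, D A (S.erase i) (T.erase j) *
          (3 / 2 * w ^ (3 + (row (tr A) S j).card)) ≤ 1 / 3 := by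
        intro j hj
        have a1 : w ^ (3 + (row (tr A) S j).card) ≤ w ^ 6 :=
          wpow_anti (by have := hcl j (mem_row.1 hj).1; omega)
        calc _ ≤ 1 * (3 / 2 * w ^ 6) := by
              have := (hsm j hj).1
              gcongr
          _ = 1 / 3 := by rw [w6]; norm_num
      have hsum : ∑ j ∈ row A T i, (1 / 3 : ℝ) = 1 := by
        rw [Finset.sum_const, hi3]; norm_num
      have hD := D_expand (T := T) A hi
      rw [hi3] at hD
      constructor
      · rw [hD, ← hsum]
        exact Finset.sum_le_sum hterm
      · intro h1
        rw [hD, ← hsum] at h1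
        have heq := (Finset.sum_eq_sum_iff_of_le hterm).1 h1
        have hc3 : ∀ j ∈ row A T i, (row (tr A) S j).card = 3 := by
          intro j hj
          by_contra hne
          have := hcl j (mem_row.1 hj).1
          have a1 : w ^ (3 + (row (tr A) S j).card) ≤ w ^ 7 := wpow_anti (by omega)
          have h := heq j hj
          have : D A (S.erase i) (T.erase j) *
            (3 / 2 * w ^ (3 + (row (tr A) S j).card)) ≤ 1 * (3 / 2 * w ^ 7) := by
              have := (hsm j hj).1
              gcongr
          rw [h, w7] at this
          linarith [w_hi]
        refine five_isJ hr hi hi3 hc3 fun j hj => (hsm j hj).2 ?_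
        have h := heq j hj
        rw [hc3 j hj, w6] at h
        linarith
    have lt1 : D A S T < 1 → D A S T ≤ 1 ∧ (D A S T = 1 → IsJ A S T) :=
      fun h => ⟨h.le, fun h' => absurd h' h.ne⟩
    rcases S.eq_empty_or_nonempty with rfl | hne
    · have : T = ∅ := by rw [← Finset.card_eq_zero, hT, ← hS]; rfl
      subst this
      exact ⟨(D_empty A).le, fun _ => ⟨by simp, by simp, by simp, by simp⟩⟩
    rcases step hc hE hne with h | ⟨i, hi, j, hj, -, h⟩ | ⟨R, C, h1, h2, h3⟩ | ⟨-, h⟩ | h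
    · exact lt1 (by linarith [w5_hi])
    · apply lt1
      have := hE A _ _ (card_er hi hj hc) (Finset.card_erase_lt_of_mem hi)
      have h2 : 0 < w ^ 2 := by positivity
      rw [h]
      nlinarith [w2_hi]
    · have c1 := Finset.card_sdiff_add_card_eq_card h3.rs
      have c2 := Finset.card_sdiff_add_card_eq_card h3.ct
      rw [h3.D_two h1 h2, ← isJ_blk h3 (by omega) (by omega)]
      exact ih (S \ R).card (by omega) A _ _ rfl (by omega)
    · apply lt1
      have four : ∀ (A : ι → ι → Bool) (S T : Finset ι), S.card = N → T.card = N →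
          CaseFour A S T → D A S T < 1 := by
        rintro A S T hS hT ⟨i, hi, j, k, hjk, hr, h1, h2⟩
        rw [D_expand A hi, hr, Finset.sum_pair hjk, h1, h2, Finset.card_pair hjk]
        have hjT : j ∈ T := (mem_row.1 (by simp [hr] : j ∈ row A T i)).1
        have hkT : k ∈ T := (mem_row.1 (by simp [hr] : k ∈ row A T i)).1
        have hlt := Finset.card_erase_lt_of_mem hi
        have e1 := (ih (S.erase i).card (by omega) A _ _ rfl (card_er hi hjT (by omega)).symm).1
        have e2 := (ih (S.erase i).card (by omega) A _ _ rfl (card_er hi hkT (by omega)).symm).1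
        have h5 : 0 < w ^ 5 := by positivity
        nlinarith [w5_hi]
      rcases h with h | h
      · exact four A S T hS hT h
      · rw [← D_tr A hc]; exact four _ _ _ hT hS h
    · rcases h with h | h
      · exact five A S T hS hT h
      · have := five _ _ _ hT hS h
        rw [D_tr A hc] at this
        exact ⟨this.1, fun h => (this.2 h).tr⟩

lemma small_all (N : ℕ) : Small ι N := fun B S T h _ => (main_E S.card B S T rfl h.symm).1

lemma four_le {A : ι → ι → Bool} {S T : Finset ι} (hc : S.card = T.card) (h : CaseFour A S T) :
    D A S T ≤ 3 * w ^ 5 ∧ (D A S T = 3 * w ^ 5 → IsN A S T) := by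
  obtain ⟨i, hi, j, k, hjk, hr, h1, h2⟩ := h
  have hjT : j ∈ T := (mem_row.1 (by simp [hr] : j ∈ row A T i)).1
  have hkT : k ∈ T := (mem_row.1 (by simp [hr] : k ∈ row A T i)).1
  have e1 := main_E (S.erase i).card A _ _ rfl (card_er hi hjT (by omega)).symm
  have e2 := main_E (S.erase i).card A _ _ rfl (card_er hi hkT (by omega)).symm
  have h5 : 0 < w ^ 5 := by have := w_pos; positivity
  have hD := D_expand (T := T) A hi
  rw [hr, Finset.sum_pair hjk, h1, h2, Finset.card_pair hjk] at hD
  norm_num at hD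
  constructor
  · rw [hD]; nlinarith [e1.1, e2.1]
  · intro h
    rw [hD] at h
    have : D A (S.erase i) (T.erase j) + D A (S.erase i) (T.erase k) = 2 := by
      have : (D A (S.erase i) (T.erase j) + D A (S.erase i) (T.erase k) - 2) * w ^ 5 = 0 := by
        linarith
      rcases mul_eq_zero.1 this with h | h
      · linarith
      · exact absurd h h5.ne'
    exact four_isN hi hjk hr h1 h2 (e1.2 (by linarith [e1.1, e2.1])) (e2.2 (by linarith [e1.1, e2.1]))

/-- parity bound -/
theorem main_Q1 : ∀ (N : ℕ) (A : ι → ι → Bool) (S T : Finset ι), S.card = N → T.card = N →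
    (N + ones A S T) % 2 = 1 → D A S T ≤ 3 / 2 * w ^ 2 := by
  intro N
  induction N using Nat.strong_induction_on with
  | _ N ih =>
    intro A S T hS hT hodd
    have hw := w_pos
    have hc : S.card = T.card := by omega
    have five : ∀ (A : ι → ι → Bool) (S T : Finset ι), S.card = N → T.card = N →
        (N + ones A S T) % 2 = 1 → CaseFive A S T → D A S T ≤ 3 / 2 * w ^ 2 := by
      rintro A S T hS hT hodd ⟨hr, hcl, i, hi, hi3⟩
      have hSp := Finset.card_pos.2 ⟨i, hi⟩
      have hse := Finset.card_erase_of_mem hi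
      have hterm : ∀ j ∈ row A T i, D A (S.erase i) (T.erase j) *
          (3 / 2 * w ^ (3 + (row (tr A) S j).card)) ≤ 1 / 2 * w ^ 2 := by
        intro j hj
        have hTe := Finset.card_erase_of_mem (mem_row.1 hj).1
        have ho := ones_minor A hi hj
        have h3 := hcl j (mem_row.1 hj).1
        by_cases hc3 : (row (tr A) S j).card = 3
        · rw [hc3, w6]
          have := ih (N - 1) (by omega) A _ _ (by omega) (by omega)
            (by omega : (N - 1 + ones A (S.erase i) (T.erase j)) % 2 = 1)
          linarith
        · have a1 : w ^ (3 + (row (tr A) S j).card) ≤ w ^ 7 := wpow_anti (by omega)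
          calc _ ≤ 1 * (3 / 2 * w ^ 7) := by
                have := (main_E (N - 1) A (S.erase i) (T.erase j) (by omega) (by omega)).1
                gcongr
            _ ≤ _ := by rw [w7]; linarith [w_hi, w2_lo]
      have hD := D_expand (T := T) A hi
      rw [hi3] at hD
      rw [hD]
      refine (Finset.sum_le_sum hterm).trans ?_
      rw [Finset.sum_const, hi3, nsmul_eq_mul]
      push_cast
      linarith
    rcases S.eq_empty_or_nonempty with rfl | hne
    · simp [ones] at hodd; simp at hS; omega
    rcases step hc (small_all _) hne with h | ⟨i, hi, j, hj, -, h⟩ | ⟨R, C, h1, h2, h3⟩ | ⟨-, h⟩ | h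
    · linarith [w5_hi, w2_lo]
    · have := (main_E _ A (S.erase i) (T.erase j) rfl (card_er hi hj hc).symm).1
      have h2 : 0 < w ^ 2 := by positivity
      rw [h]
      nlinarith
    · have c1 := Finset.card_sdiff_add_card_eq_card h3.rs
      have c2 := Finset.card_sdiff_add_card_eq_card h3.ct
      have ho := h3.ones
      rw [h1, h2] at ho
      rw [h3.D_two h1 h2]
      exact ih (S \ R).card (by omega) A _ _ rfl (by omega) (by omega)
    · rcases h with h | h
      · linarith [(four_le hc h).1, w5_hi, w2_lo]
      · have := (four_le hc.symm h).1
        rw [D_tr A hc] at this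
        linarith [w5_hi, w2_lo]
    · rcases h with h | h
      · exact five A S T hS hT hodd h
      · have := five _ _ _ hT hS (by rw [ones_tr A S T]; exact hodd) h
        rw [D_tr A hc] at this
        exact this

theorem main_Q2 : ∀ (N : ℕ) (A : ι → ι → Bool) (S T : Finset ι), S.card = N → T.card = N →
    (N + ones A S T) % 6 = 5 → D A S T ≤ 3 * w ^ 5 ∧ (D A S T = 3 * w ^ 5 → IsN A S T) := by
  intro N
  induction N using Nat.strong_induction_on with
  | _ N ih =>
    intro A S T hS hT hodd
    have hw := w_pos
    have hc : S.card = T.card := by omega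
    have five : ∀ (A : ι → ι → Bool) (S T : Finset ι), S.card = N → T.card = N →
        (N + ones A S T) % 6 = 5 → CaseFive A S T → D A S T < 3 * w ^ 5 := by
      rintro A S T hS hT hodd ⟨hr, hcl, i, hi, hi3⟩
      have hSp := Finset.card_pos.2 ⟨i, hi⟩
      have hse := Finset.card_erase_of_mem hi
      have hbig : ∀ j ∈ row A T i, (row (tr A) S j).card ≠ 3 → D A (S.erase i) (T.erase j) *
          (3 / 2 * w ^ (3 + (row (tr A) S j).card)) < w ^ 5 := by
        intro j hj hc3
        have hTe := Finset.card_erase_of_mem (mem_row.1 hj).1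
        have h3 := hcl j (mem_row.1 hj).1
        have a1 : w ^ (3 + (row (tr A) S j).card) ≤ w ^ 7 := wpow_anti (by omega)
        calc _ ≤ 1 * (3 / 2 * w ^ 7) := by
              have := (main_E (N - 1) A (S.erase i) (T.erase j) (by omega) (by omega)).1
              gcongr
          _ < _ := by rw [w7]; linarith [w_hi, w5_lo]
      have hsmall : ∀ j ∈ row A T i, (row (tr A) S j).card = 3 →
          D A (S.erase i) (T.erase j) ≤ 3 * w ^ 5 ∧
          (D A (S.erase i) (T.erase j) = 3 * w ^ 5 → IsN A (S.erase i) (T.erase j)) := by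
        intro j hj hc3
        have hTe := Finset.card_erase_of_mem (mem_row.1 hj).1
        have ho := ones_minor A hi hj
        exact ih (N - 1) (by omega) A _ _ (by omega) (by omega)
            (by omega : (N - 1 + ones A (S.erase i) (T.erase j)) % 6 = 5)
      have hterm : ∀ j ∈ row A T i, D A (S.erase i) (T.erase j) *
          (3 / 2 * w ^ (3 + (row (tr A) S j).card)) ≤ w ^ 5 := by
        intro j hj
        by_cases hc3 : (row (tr A) S j).card = 3
        · have := (hsmall j hj hc3).1
          rw [hc3, w6]
          linarith
        · exact (hbig j hj hc3).le
      have hD := D_expand (T := T) A hi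
      rw [hi3] at hD
      have hsum : ∑ j ∈ row A T i, w ^ 5 = 3 * w ^ 5 := by
        rw [Finset.sum_const, hi3, nsmul_eq_mul]; norm_num
      have hle : D A S T ≤ 3 * w ^ 5 := by
        rw [hD, ← hsum]; exact Finset.sum_le_sum hterm
      refine lt_of_le_of_ne hle fun h1 => ?_
      rw [hD, ← hsum] at h1
      have heq := (Finset.sum_eq_sum_iff_of_le hterm).1 h1
      have hc3 : ∀ j ∈ row A T i, (row (tr A) S j).card = 3 := by
        intro j hj
        by_contra hne
        exact (hbig j hj hne).ne (heq j hj)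
      obtain ⟨j1, j2, j3, h12, h13, h23, hrw⟩ := Finset.card_eq_three.1 hi3
      have m1 : j1 ∈ row A T i := by simp [hrw]
      have m2 : j2 ∈ row A T i := by simp [hrw]
      have m3 : j3 ∈ row A T i := by simp [hrw]
      have hN : IsN A (S.erase i) (T.erase j1) := by
        apply (hsmall j1 m1 (hc3 j1 m1)).2
        have h := heq j1 m1
        rw [hc3 j1 m1, w6] at h
        linarith
      have ho := ones_minor A hi m1
      rw [hi3, hc3 j1 m1] at ho
      have hT1 := Finset.card_erase_of_mem (mem_row.1 m1).1
      have n2 : j2 ∈ T.erase j1 := Finset.mem_erase.2 ⟨h12.symm, (mem_row.1 m2).1⟩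
      have n3 : j3 ∈ (T.erase j1).erase j2 :=
        Finset.mem_erase.2 ⟨h23.symm, Finset.mem_erase.2 ⟨h13.symm, (mem_row.1 m3).1⟩⟩
      have n3' : j3 ∈ T.erase j1 := Finset.mem_of_mem_erase n3
      have hcard2 : ∀ j ∈ row A T i, (row (tr A) (S.erase i) j).card = 2 := by
        intro j hj
        rw [row_erase, Finset.card_erase_of_mem (mem_row.2 ⟨hi, (mem_row.1 hj).2⟩), hc3 j hj]
      have hup : ones A (S.erase i) (T.erase j1) ≤ 3 * ((T.erase j1).erase j2 |>.erase j3).card + 4 := by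
        rw [← ones_tr, ones_split _ n2, ones_split _ n3, hcard2 j2 m2, hcard2 j3 m3]
        have : ones (tr A) (((T.erase j1).erase j2).erase j3) (S.erase i) ≤
            3 * (((T.erase j1).erase j2).erase j3).card := by
          unfold ones
          rw [mul_comm, ← smul_eq_mul, ← Finset.sum_const]
          refine Finset.sum_le_sum fun j hj => ?_
          exact hN.col_le (Finset.mem_of_mem_erase (Finset.mem_of_mem_erase hj))
        omega
      have k2 := Finset.card_erase_add_one n2
      have k3 := Finset.card_erase_add_one n3
      have hlow : 3 * N ≤ ones A S T := by
        unfold ones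
        rw [← hS, mul_comm, ← smul_eq_mul, ← Finset.sum_const]
        exact Finset.sum_le_sum fun j hj => hr j hj
      omega
    have lt1 : D A S T < 3 * w ^ 5 →
        D A S T ≤ 3 * w ^ 5 ∧ (D A S T = 3 * w ^ 5 → IsN A S T) :=
      fun h => ⟨h.le, fun h' => absurd h' h.ne⟩
    rcases S.eq_empty_or_nonempty with rfl | hne
    · simp [ones] at hodd; simp at hS; omega
    rcases step hc (small_all _) hne with h | ⟨i, hi, j, hj, ho, h⟩ | ⟨R, C, h1, h2, h3⟩ | ⟨-, h⟩ | h
    · exact lt1 h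
    · apply lt1
      have hse := Finset.card_erase_add_one hi
      have := main_Q1 _ A (S.erase i) (T.erase j) rfl (card_er hi hj hc).symm (by omega)
      rw [h]
      nlinarith [w2_hi, w2_lo, w5_lo]
    · have c1 := Finset.card_sdiff_add_card_eq_card h3.rs
      have c2 := Finset.card_sdiff_add_card_eq_card h3.ct
      have ho := h3.ones
      rw [h1, h2] at ho
      rw [h3.D_two h1 h2]
      have := ih (S \ R).card (by omega) A (S \ R) (T \ C) rfl (by omega) (by omega)
      exact ⟨this.1, fun h => isN_blk h3 h1 h2 (this.2 h)⟩
    · rcases h with h | h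
      · exact four_le hc h
      · have := four_le hc.symm h
        rw [D_tr A hc] at this
        exact ⟨this.1, fun h => (this.2 h).tr⟩
    · rcases h with h | h
      · exact lt1 (five A S T hS hT hodd h)
      · have := five _ _ _ hT hS (by rw [ones_tr A S T]; exact hodd) h
        rw [D_tr A hc] at this
        exact lt1 this

end Comb3
end BGM

namespace BGM
section Iso
set_option linter.unusedSectionVars false
variable {ι : Type} [DecidableEq ι]

/-- two relations agree up to bijections of rows and columns -/
def Iso (A : ι → ι → Bool) (S T : Finset ι) (B : ι → ι → Bool) (S' T' : Finset ι) : Prop :=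
  ∃ e f : ι → ι, Set.BijOn e S S' ∧ Set.BijOn f T T' ∧ ∀ i ∈ S, ∀ j ∈ T, A i j = B (e i) (f j)

lemma bijOn_glue {e₁ e₂ : ι → ι} {S R S' R' : Finset ι} (hR : R ⊆ S) (hR' : R' ⊆ S')
    (h1 : Set.BijOn e₁ R R') (h2 : Set.BijOn e₂ (S \ R : Finset ι) (S' \ R' : Finset ι)) :
    Set.BijOn (fun x => if x ∈ R then e₁ x else e₂ x) S S' := by
  obtain ⟨m1, i1, s1⟩ := h1
  obtain ⟨m2, i2, s2⟩ := h2
  have m1' : ∀ x ∈ R, e₁ x ∈ R' := fun x hx => m1 hx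
  have m2' : ∀ x ∈ S, x ∉ R → e₂ x ∈ S' ∧ e₂ x ∉ R' := fun x hx hx' => by
    have := @m2 x (by simp [hx, hx'])
    simpa using this
  refine ⟨?_, ?_, ?_⟩
  · intro x hx
    by_cases hxR : x ∈ R
    · simp only [hxR, if_true]; exact hR' (m1' x hxR)
    · simp only [hxR, if_false]; exact (m2' x hx hxR).1
  · intro x hx y hy hxy
    by_cases hxR : x ∈ R <;> by_cases hyR : y ∈ R <;> simp only [hxR, hyR, if_true, if_false] at hxy
    · exact i1 hxR hyR hxy
    · exact absurd (hxy ▸ m1' x hxR) (m2' y hy hyR).2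
    · exact absurd (hxy ▸ m1' y hyR) (m2' x hx hxR).2
    · refine i2 ?_ ?_ hxy
      · simp only [Finset.coe_sdiff]; exact ⟨hx, hxR⟩
      · simp only [Finset.coe_sdiff]; exact ⟨hy, hyR⟩
  · intro y hy
    by_cases hyR : y ∈ R'
    · obtain ⟨x, hx, rfl⟩ := s1 hyR
      have hx : x ∈ R := hx
      exact ⟨x, hR hx, by simp [hx]⟩
    · obtain ⟨x, hx, rfl⟩ := @s2 y (by simp only [Finset.coe_sdiff]; exact ⟨hy, hyR⟩)
      simp only [Finset.coe_sdiff] at hx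
      have hxR : x ∉ R := hx.2
      exact ⟨x, hx.1, by simp [hxR]⟩

lemma Iso.glue {A B : ι → ι → Bool} {S T S' T' R C R' C' : Finset ι} (hR : R ⊆ S) (hR' : R' ⊆ S')
    (hC : C ⊆ T) (hC' : C' ⊆ T') (h1 : Iso A R C B R' C')
    (h2 : Iso A (S \ R) (T \ C) B (S' \ R') (T' \ C'))
    (hA : ∀ i ∈ S, ∀ j ∈ T, A i j = true → (i ∈ R ↔ j ∈ C))
    (hB : ∀ i ∈ S', ∀ j ∈ T', B i j = true → (i ∈ R' ↔ j ∈ C')) : Iso A S T B S' T' := by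
  obtain ⟨e₁, f₁, he₁, hf₁, h1⟩ := h1
  obtain ⟨e₂, f₂, he₂, hf₂, h2⟩ := h2
  refine ⟨_, _, bijOn_glue hR hR' he₁ he₂, bijOn_glue hC hC' hf₁ hf₂, ?_⟩
  intro i hi j hj
  have a1 : ∀ x ∈ R, e₁ x ∈ R' := fun x hx => he₁.1 hx
  have a2 : ∀ x ∈ C, f₁ x ∈ C' := fun x hx => hf₁.1 hx
  have a3 : ∀ x ∈ S, x ∉ R → e₂ x ∈ S' ∧ e₂ x ∉ R' := fun x hx hx' => by
    have hm := he₂.1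
    have := @hm x (by simp [hx, hx'])
    simpa using this
  have a4 : ∀ x ∈ T, x ∉ C → f₂ x ∈ T' ∧ f₂ x ∉ C' := fun x hx hx' => by
    have hm := hf₂.1
    have := @hm x (by simp [hx, hx'])
    simpa using this
  by_cases hiR : i ∈ R <;> by_cases hjC : j ∈ C <;> simp only [hiR, hjC, if_true, if_false]
  · exact h1 i hiR j hjC
  · have q1 : A i j = false := by
      by_contra h
      have := hA i hi j hj (by simpa using h)
      tauto
    have q2 : B (e₁ i) (f₂ j) = false := by
      by_contra h
      have := hB _ (hR' (a1 i hiR)) _ (a4 j hj hjC).1 (by simpa using h)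
      have := a1 i hiR
      have := a4 j hj hjC
      tauto
    rw [q1, q2]
  · have q1 : A i j = false := by
      by_contra h
      have := hA i hi j hj (by simpa using h)
      tauto
    have q2 : B (e₂ i) (f₁ j) = false := by
      by_contra h
      have := hB _ (a3 i hi hiR).1 _ (hC' (a2 j hjC)) (by simpa using h)
      have := a3 i hi hiR
      have := a2 j hjC
      tauto
    rw [q1, q2]
  · exact h2 i (by simp [hi, hiR]) j (by simp [hj, hjC])

lemma exists_bijOn {S S' : Finset ι} (h : S.card = S'.card) : ∃ e : ι → ι, Set.BijOn e S S' := by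
  classical
  have hc : Nat.card S = Nat.card S' := by simp [h]
  let q : S ≃ S' := Finset.equivOfCardEq h
  refine ⟨fun x => if hx : x ∈ S then (q ⟨x, hx⟩ : ι) else x, ?_, ?_, ?_⟩
  · intro x hx
    have hx : x ∈ S := hx
    simp [hx]
  · intro x hx y hy hxy
    have hx : x ∈ S := hx
    have hy : y ∈ S := hy
    simp only [hx, hy, dif_pos] at hxy
    simpa using q.injective (Subtype.ext hxy)
  · intro y hy
    have hy : y ∈ S' := hy
    refine ⟨(q.symm ⟨y, hy⟩ : ι), (q.symm ⟨y, hy⟩).2, ?_⟩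
    simp

/-- a bijection respecting a marked point -/
lemma exists_bijOn_pt {S S' : Finset ι} (h : S.card = S'.card) {i i' : ι} (hi : i ∈ S)
    (hi' : i' ∈ S') : ∃ e : ι → ι, Set.BijOn e S S' ∧ e i = i' ∧ ∀ x ∈ S, x ≠ i → e x ≠ i' := by
  obtain ⟨e, he⟩ := exists_bijOn (S := S \ {i}) (S' := S' \ {i'})
    (by rw [Finset.card_sdiff_of_subset (by simpa using hi),
      Finset.card_sdiff_of_subset (by simpa using hi')]; simp [h])
  have hb := bijOn_glue (R := {i}) (R' := {i'}) (S := S) (S' := S') (e₁ := fun _ => i') (e₂ := e)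
    (by simpa using hi) (by simpa using hi') (by simp) he
  refine ⟨_, hb, by simp, ?_⟩
  intro x hx hxi h
  refine hxi (hb.2.1 hx hi ?_)
  simp only at h ⊢
  rw [h]; simp

lemma IsJ.num3 {A : ι → ι → Bool} {S T : Finset ι} (h : IsJ A S T) :
    ones A S T = 2 * S.card + (S.filter fun i => (row A T i).card = 3).card := by
  unfold ones
  rw [Finset.card_filter, mul_comm, ← smul_eq_mul, ← Finset.sum_const, ← Finset.sum_add_distrib]
  refine Finset.sum_congr rfl fun i hi => ?_
  rcases h.rows i hi with h | h <;> simp [h]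

lemma IsJ.iso {A B : ι → ι → Bool} : ∀ (N : ℕ) {S T S' T' : Finset ι}, S.card = N → T.card = N →
    S'.card = N → T'.card = N → IsJ A S T → IsJ B S' T' → ones A S T = ones B S' T' →
    Iso A S T B S' T' := by
  intro N
  induction N using Nat.strong_induction_on with
  | _ N ih =>
    intro S T S' T' hS hT hS' hT' hA hB ho
    rcases Nat.eq_zero_or_pos N with h0 | hpos
    · subst h0
      rw [Finset.card_eq_zero] at hS hT hS' hT'
      subst hS hT hS' hT'
      exact ⟨id, id, by simp, by simp, by simp⟩
    obtain ⟨i, hi⟩ : S.Nonempty := Finset.card_pos.1 (by omega)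
    have hn3 : (S.filter fun i => (row A T i).card = 3).card =
        (S'.filter fun i => (row B T' i).card = 3).card := by
      have := hA.num3; have := hB.num3; omega
    obtain ⟨i', hi', hcard⟩ : ∃ i' ∈ S', (row A T i).card = (row B T' i').card := by
      rcases hA.rows i hi with h2 | h3
      · by_contra hcon
        push Not at hcon
        have : S'.filter (fun i => (row B T' i).card = 3) = S' := by
          refine Finset.filter_true_of_mem fun x hx => ?_
          have := hcon x hx
          have := hB.rows x hx
          omega
        rw [this] at hn3
        have : S.filter (fun i => (row A T i).card = 3) = S :=
          Finset.eq_of_subset_of_card_le (Finset.filter_subset _ _) (by omega)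
        have hi2 := this ▸ hi
        rw [Finset.mem_filter] at hi2
        omega
      · have : 0 < (S.filter fun i => (row A T i).card = 3).card :=
          Finset.card_pos.2 ⟨i, by simp [hi, h3]⟩
        rw [hn3] at this
        obtain ⟨i', h'⟩ := Finset.card_pos.1 this
        rw [Finset.mem_filter] at h'
        exact ⟨i', h'.1, by rw [h3, h'.2]⟩
    obtain ⟨R, hiR, hRc, hb⟩ := hA.toBlk hi
    obtain ⟨R', hiR', hRc', hb'⟩ := hB.toBlk hi'
    have hr := hA.rows i hi
    have c1 := Finset.card_sdiff_of_subset hb.rs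
    have c2 := Finset.card_sdiff_of_subset hb.ct
    have c3 := Finset.card_sdiff_of_subset hb'.rs
    have c4 := Finset.card_sdiff_of_subset hb'.ct
    have d1 := Finset.card_le_card hb.rs
    have o1 := hb.ones
    have o2 := hb'.ones
    rw [hRc] at o1
    rw [hRc', ← hcard] at o2
    refine Iso.glue hb.rs hb'.rs hb.ct hb'.ct ?_
      (ih (S \ R).card (by omega) rfl (by omega) (by omega) (by omega)
        ((isJ_blk hb hRc (by omega)).2 hA) ((isJ_blk hb' hRc' (by omega)).2 hB) (by omega))
      (fun a ha b hb2 h => hb.mem_iff ha hb2 h) (fun a ha b hb2 h => hb'.mem_iff ha hb2 h)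
    obtain ⟨e, he⟩ := exists_bijOn (S := R) (S' := R') (by omega)
    obtain ⟨f, hf⟩ := exists_bijOn hcard
    refine ⟨e, f, he, hf, ?_⟩
    intro a ha b hb2
    rw [hb.full ha hb2, hb'.full (he.1 ha) (hf.1 hb2)]

lemma mem_iff_of_IsN {A : ι → ι → Bool} {S T R C : Finset ι} {i k : ι}
    (h5 : i ∈ R) (h6 : k ∈ C)
    (h7 : row A T i = C.erase k) (h8 : ∀ l ∈ R, l ≠ i → row A T l = C)
    (h9 : row (tr A) S k = R.erase i) (h10 : ∀ l ∈ C, l ≠ k → row (tr A) S l = R) :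
    ∀ a ∈ S, ∀ b ∈ T, A a b = true → (a ∈ R ↔ b ∈ C) := by
  intro a ha b hb hA
  have hr : b ∈ row A T a := mem_row.2 ⟨hb, hA⟩
  have hcl : a ∈ row (tr A) S b := mem_row.2 ⟨ha, hA⟩
  constructor
  · intro haR
    by_cases hai : a = i
    · subst hai; rw [h7] at hr; exact Finset.mem_of_mem_erase hr
    · rwa [h8 a haR hai] at hr
  · intro hbC
    by_cases hbk : b = k
    · subst hbk; rw [h9] at hcl; exact Finset.mem_of_mem_erase hcl
    · rwa [h10 b hbC hbk] at hcl

lemma IsN_entry {A : ι → ι → Bool} {T R C : Finset ι} {i k : ι} (hCT : C ⊆ T)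
    (h7 : row A T i = C.erase k) (h8 : ∀ l ∈ R, l ≠ i → row A T l = C) :
    ∀ a ∈ R, ∀ b ∈ C, (A a b = true ↔ ¬ (a = i ∧ b = k)) := by
  intro a ha b hb
  have hr : A a b = true ↔ b ∈ row A T a := by rw [mem_row]; simp [hCT hb]
  rw [hr]
  by_cases hai : a = i
  · subst hai; rw [h7]; simp [hb]
  · rw [h8 a ha hai]; simp [hai, hb]

lemma IsN_ones {A : ι → ι → Bool} {S T R C : Finset ι} {i k : ι} (h1 : R ⊆ S)
    (h3 : R.card = 3) (h4 : C.card = 3) (h5 : i ∈ R) (h6 : k ∈ C)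
    (h7 : row A T i = C.erase k) (h8 : ∀ l ∈ R, l ≠ i → row A T l = C)
    (h9 : row (tr A) S k = R.erase i) (h10 : ∀ l ∈ C, l ≠ k → row (tr A) S l = R) :
    ones A S T = ones A (S \ R) (T \ C) + 8 := by
  have hm := mem_iff_of_IsN h5 h6 h7 h8 h9 h10
  unfold BGM.ones
  rw [← Finset.sum_sdiff h1]
  congr 1
  · refine Finset.sum_congr rfl fun a ha => ?_
    rw [Finset.mem_sdiff] at ha
    congr 1
    ext b
    simp only [mem_row, Finset.mem_sdiff]
    have := hm a ha.1 b
    tauto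
  · rw [← Finset.sum_erase_add _ _ h5, h7, Finset.card_erase_of_mem h6, h4,
      Finset.sum_congr rfl (fun a ha => by
        rw [h8 a (Finset.mem_of_mem_erase ha) (Finset.ne_of_mem_erase ha), h4]),
      Finset.sum_const, Finset.card_erase_of_mem h5, h3]
    rfl

lemma IsN.iso {A B : ι → ι → Bool} {S T S' T' : Finset ι} (hST : S.card = T.card)
    (hSS : S.card = S'.card) (hST' : S'.card = T'.card) (hA : IsN A S T) (hB : IsN B S' T')
    (ho : ones A S T = ones B S' T') : Iso A S T B S' T' := by
  obtain ⟨R, C, i, k, h1, h2, h3, h4, h5, h6, h7, h8, h9, h10, h11⟩ := hA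
  obtain ⟨R', C', i', k', g1, g2, g3, g4, g5, g6, g7, g8, g9, g10, g11⟩ := hB
  have o1 := IsN_ones h1 h3 h4 h5 h6 h7 h8 h9 h10
  have o2 := IsN_ones g1 g3 g4 g5 g6 g7 g8 g9 g10
  have c1 := Finset.card_sdiff_of_subset h1
  have c2 := Finset.card_sdiff_of_subset h2
  have c3 := Finset.card_sdiff_of_subset g1
  have c4 := Finset.card_sdiff_of_subset g2
  refine Iso.glue h1 g1 h2 g2 ?_
    (IsJ.iso (S \ R).card rfl (by omega) (by omega) (by omega) h11 g11 (by omega))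
    (mem_iff_of_IsN h5 h6 h7 h8 h9 h10) (mem_iff_of_IsN g5 g6 g7 g8 g9 g10)
  obtain ⟨e, he, hei, hen⟩ := exists_bijOn_pt (h3.trans g3.symm) h5 g5
  obtain ⟨f, hf, hfk, hfn⟩ := exists_bijOn_pt (h4.trans g4.symm) h6 g6
  refine ⟨e, f, he, hf, ?_⟩
  intro a ha b hb
  rw [Bool.eq_iff_iff, IsN_entry h2 h7 h8 a ha b hb,
    IsN_entry g2 g7 g8 _ (he.1 ha) _ (hf.1 hb), not_iff_not]
  constructor
  · rintro ⟨rfl, rfl⟩; exact ⟨hei, hfk⟩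
  · rintro ⟨q1, q2⟩
    constructor
    · by_contra hh; exact hen a ha hh q1
    · by_contra hh; exact hfn b hb hh q2

end Iso
end BGM

namespace BGM

/-- Boolean version of a matrix -/
def bm {n : ℕ} (M : Matrix (Fin n) (Fin n) ℕ) : Fin n → Fin n → Bool :=
  fun i j => decide (M i j = 1)

lemma perm_eq_pr {n : ℕ} {M : Matrix (Fin n) (Fin n) ℕ} (hM : IsZeroOne M) :
    perm M = pr (bm M) Finset.univ Finset.univ := by
  have h1 : perm M = (Finset.univ.filter fun φ : Equiv.Perm (Fin n) => ∀ i, M i (φ i) = 1).card := by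
    unfold perm
    rw [Finset.card_filter]
    refine Finset.sum_congr rfl fun φ _ => ?_
    split_ifs with h
    · exact Finset.prod_eq_one fun i _ => h i
    · push Not at h
      obtain ⟨i, hi⟩ := h
      exact Finset.prod_eq_zero (Finset.mem_univ i) ((hM i (φ i)).resolve_right hi)
  rw [h1]
  unfold pr
  refine Finset.card_bij (fun φ _ => Finset.univ.image fun i => (i, φ i)) ?_ ?_ ?_
  · intro φ hφ
    rw [Finset.mem_filter] at hφ
    rw [mem_PM]
    refine ⟨by simp, ?_, ?_, ?_⟩
    · intro p hp
      simp only [Finset.mem_image, Finset.mem_univ, true_and] at hp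
      obtain ⟨i, rfl⟩ := hp
      simpa [bm] using hφ.2 i
    · intro i _
      exact ⟨φ i, by simp, by simp⟩
    · intro j _
      refine ⟨φ.symm j, by simp, ?_⟩
      intro y hy
      simp only [Finset.mem_image, Finset.mem_univ, true_and, Prod.mk.injEq] at hy
      obtain ⟨a, rfl, rfl⟩ := hy
      simp
  · intro φ _ ψ _ h
    ext1 i
    have : (i, φ i) ∈ Finset.univ.image fun i => (i, ψ i) := by
      rw [← h]; simp
    simp only [Finset.mem_image, Finset.mem_univ, true_and, Prod.mk.injEq] at this
    obtain ⟨a, rfl, h⟩ := this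
    exact h.symm
  · intro X hX
    rw [mem_PM] at hX
    obtain ⟨-, h2, h3, h4⟩ := hX
    choose f hf hfu using fun i => h3 i (Finset.mem_univ i)
    have hinj : Function.Injective f := by
      intro a b hab
      obtain ⟨c, -, hc⟩ := h4 (f a) (Finset.mem_univ _)
      rw [hc a (hf a), hc b (by simp only; rw [hab]; exact hf b)]
    refine ⟨Equiv.ofBijective f (Finite.injective_iff_bijective.1 hinj), ?_, ?_⟩
    · rw [Finset.mem_filter]
      refine ⟨Finset.mem_univ _, fun i => ?_⟩
      have := h2 _ (hf i)
      simpa [bm] using this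
    · ext ⟨a, b⟩
      simp only [Finset.mem_image, Finset.mem_univ, true_and, Prod.mk.injEq, Equiv.ofBijective_apply]
      constructor
      · rintro ⟨x, rfl, rfl⟩; exact hf x
      · intro h; exact ⟨a, rfl, (hfu a b h).symm⟩

lemma ones_eq {n : ℕ} (M : Matrix (Fin n) (Fin n) ℕ) (hM : IsZeroOne M) :
    ones (bm M) Finset.univ Finset.univ = ∑ i, ∑ j, M i j := by
  unfold ones
  refine Finset.sum_congr rfl fun i _ => ?_
  unfold row
  rw [Finset.card_filter]
  refine Finset.sum_congr rfl fun j _ => ?_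
  rcases hM i j with h | h <;> simp [bm, h]

lemma ones_add_zeroCount {n : ℕ} (M : Matrix (Fin n) (Fin n) ℕ) (hM : IsZeroOne M) :
    ∑ i, ∑ j, M i j + zeroCount M = n ^ 2 := by
  unfold zeroCount
  rw [Finset.card_filter, Fintype.sum_prod_type, ← Finset.sum_add_distrib]
  have : ∀ i j, M i j + (if M i j = 0 then 1 else 0) = 1 := by
    intro i j
    rcases hM i j with h | h <;> simp [h]
  simp only [← Finset.sum_add_distrib, this]
  simp [sq]

lemma perm_eq_permanent {n : ℕ} (M : Matrix (Fin n) (Fin n) ℕ) : perm M = M.permanent := by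
  rw [← Matrix.permanent_transpose]; rfl

lemma PAQ_apply {n : ℕ} {P Q A : Matrix (Fin n) (Fin n) ℕ} {e f : Equiv.Perm (Fin n)}
    (hP : ∀ i j, P i j = if j = e i then 1 else 0) (hQ : ∀ i j, Q i j = if j = f i then 1 else 0) :
    P * A * Q = A.submatrix e f.symm := by
  ext i j
  simp only [Matrix.mul_apply, hP, hQ, Matrix.submatrix_apply]
  simp only [ite_mul, one_mul, zero_mul, Finset.sum_ite_eq', Finset.mem_univ, if_true]
  have : ∀ x, (j = f x) ↔ (f.symm j = x) := fun x => by rw [Equiv.symm_apply_eq]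
  simp [this]

lemma perm_submatrix {n : ℕ} (A : Matrix (Fin n) (Fin n) ℕ) (e f : Equiv.Perm (Fin n)) :
    (A.submatrix e f).permanent = A.permanent := by
  have : A.submatrix e f = (A.submatrix e id).submatrix id f := by ext; simp
  rw [this, Matrix.permanent_permute_rows, Matrix.permanent_permute_cols]

lemma CombEquiv.perm_eq {n : ℕ} {A B : Matrix (Fin n) (Fin n) ℕ} (h : CombEquiv A B) :
    perm B = perm A := by
  obtain ⟨P, Q, ⟨e, hP⟩, ⟨f, hQ⟩, h | h⟩ := h
  · rw [h, PAQ_apply hP hQ, perm_eq_permanent, perm_eq_permanent, perm_submatrix]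
  · rw [h, PAQ_apply hP hQ, perm_eq_permanent, perm_eq_permanent, perm_submatrix,
      Matrix.permanent_transpose]

lemma combEquiv_of_iso {n : ℕ} {A B : Matrix (Fin n) (Fin n) ℕ} (hA : IsZeroOne A)
    (hB : IsZeroOne B)
    (h : Iso (bm B) Finset.univ Finset.univ (bm A) Finset.univ Finset.univ) : CombEquiv A B := by
  obtain ⟨e, f, he, hf, h⟩ := h
  rw [Finset.coe_univ, Set.bijOn_univ] at he hf
  let e' := Equiv.ofBijective e he
  let f' := Equiv.ofBijective f hf
  refine ⟨Matrix.of fun i j => if j = e' i then 1 else 0,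
    Matrix.of fun i j => if j = f'.symm i then 1 else 0, ⟨e', fun i j => rfl⟩,
    ⟨f'.symm, fun i j => rfl⟩, Or.inl ?_⟩
  rw [PAQ_apply (P := Matrix.of fun i j => if j = e' i then 1 else 0)
    (Q := Matrix.of fun i j => if j = f'.symm i then 1 else 0) (e := e') (f := f'.symm)
    (fun i j => rfl) (fun i j => rfl)]
  ext i j
  have := h i (Finset.mem_univ _) j (Finset.mem_univ _)
  simp only [Matrix.submatrix_apply, Equiv.symm_symm]
  change B i j = A (e i) (f j)
  simp only [bm, decide_eq_decide] at this
  have h1 := hA (e i) (f j)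
  have h2 := hB i j
  omega

/-- number of positions in the block of `x` -/
def gcount (L : List ℕ) (x : ℕ) : ℕ :=
  ∑ y ∈ Finset.range L.sum, if blockIdx L x = blockIdx L y then 1 else 0

lemma gcount_cons_lt {s : ℕ} {L : List ℕ} {x : ℕ} (hx : x < s) : gcount (s :: L) x = s := by
  unfold gcount
  rw [List.sum_cons, Finset.sum_range_add]
  rw [Finset.sum_congr rfl (g := fun _ => 1) (fun y hy => by
    simp [blockIdx, hx, Finset.mem_range.1 hy])]
  simp [blockIdx, hx]

lemma gcount_cons_ge {s : ℕ} {L : List ℕ} {x : ℕ} : gcount (s :: L) (s + x) = gcount L x := by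
  unfold gcount
  rw [List.sum_cons, Finset.sum_range_add]
  rw [Finset.sum_congr rfl (g := fun _ => 0) (fun y hy => by
    simp [blockIdx, Finset.mem_range.1 hy])]
  simp [blockIdx]

lemma gcount_mem : ∀ (L : List ℕ) (x : ℕ), x < L.sum → gcount L x ∈ L
  | [], x, h => by simp at h
  | s :: L, x, h => by
    by_cases hx : x < s
    · rw [gcount_cons_lt hx]; simp
    · obtain ⟨y, rfl⟩ := Nat.exists_eq_add_of_le (not_lt.1 hx)
      rw [gcount_cons_ge]
      rw [List.sum_cons] at h
      exact List.mem_cons_of_mem _ (gcount_mem L y (by omega))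

lemma gcount_sum : ∀ (L : List ℕ),
    ∑ x ∈ Finset.range L.sum, gcount L x = (L.map fun s => s * s).sum
  | [] => by simp
  | s :: L => by
    rw [List.sum_cons, Finset.sum_range_add]
    rw [Finset.sum_congr rfl (fun x hx => gcount_cons_lt (Finset.mem_range.1 hx))]
    simp only [gcount_cons_ge]
    rw [gcount_sum L]
    simp

section Head
variable {n : ℕ} {L : List ℕ}

lemma head_lt {i j : Fin n} (hi : (i : ℕ) < 3) (hj : (j : ℕ) < 3) :
    headBlocks n A3 L i j = if (i : ℕ) = 0 ∧ (j : ℕ) = 0 then 0 else 1 := by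
  simp only [headBlocks, Matrix.of_apply, hi, hj, and_self, dif_pos, A3]
  simp [Fin.ext_iff]

lemma head_mixed {i j : Fin n} (h : ¬ ((i : ℕ) < 3 ↔ (j : ℕ) < 3)) :
    headBlocks n A3 L i j = 0 := by
  have h1 : ¬ ((i : ℕ) < 3 ∧ (j : ℕ) < 3) := by tauto
  have h2 : ¬ (3 ≤ (i : ℕ) ∧ 3 ≤ (j : ℕ) ∧ blockIdx L (i - 3) = blockIdx L (j - 3)) := by omega
  simp only [headBlocks, Matrix.of_apply, h1, h2, if_false, dite_false]

lemma head_ge {i j : Fin n} (hi : 3 ≤ (i : ℕ)) (hj : 3 ≤ (j : ℕ)) :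
    headBlocks n A3 L i j = if blockIdx L (i - 3) = blockIdx L (j - 3) then 1 else 0 := by
  have h1 : ¬ ((i : ℕ) < 3 ∧ (j : ℕ) < 3) := by omega
  simp only [headBlocks, Matrix.of_apply, h1, dite_false, hi, hj, true_and]

lemma head_zeroOne : IsZeroOne (headBlocks n A3 L) := by
  intro i j
  by_cases h : ((i : ℕ) < 3 ↔ (j : ℕ) < 3)
  · by_cases hi : (i : ℕ) < 3
    · rw [head_lt hi (h.1 hi)]; split_ifs <;> simp
    · rw [head_ge (by omega) (by omega)]; split_ifs <;> simp
  · left; exact head_mixed h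

lemma head_symm (i j : Fin n) : headBlocks n A3 L i j = headBlocks n A3 L j i := by
  by_cases h : ((i : ℕ) < 3 ↔ (j : ℕ) < 3)
  · by_cases hi : (i : ℕ) < 3
    · rw [head_lt hi (h.1 hi), head_lt (h.1 hi) hi]; simp only [and_comm]
    · rw [head_ge (by omega) (by omega), head_ge (by omega) (by omega)]; simp only [eq_comm]
  · rw [head_mixed h, head_mixed (by tauto)]

lemma head_tr : tr (bm (headBlocks n A3 L)) = bm (headBlocks n A3 L) := by
  funext i j
  simp only [tr, bm, head_symm j i]

/-- first three indices -/
def hd (n : ℕ) : Finset (Fin n) := Finset.univ.filter fun i => (i : ℕ) < 3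

lemma hd_card (h : 3 ≤ n) : (hd n).card = 3 := by
  have : hd n = Finset.univ.map (Fin.castLEEmb h) := by
    ext x
    simp only [hd, Finset.mem_filter, Finset.mem_univ, true_and, Finset.mem_map, Fin.castLEEmb_apply]
    constructor
    · intro hx; exact ⟨⟨x, hx⟩, rfl⟩
    · rintro ⟨a, rfl⟩; exact a.2
  rw [this, Finset.card_map]; simp

lemma mem_hd {i : Fin n} : i ∈ hd n ↔ (i : ℕ) < 3 := by simp [hd]

lemma sum_fin_split (hL : 3 + L.sum = n) (F : ℕ → ℕ) :
    ∑ i : Fin n, F i = F 0 + F 1 + F 2 + ∑ x ∈ Finset.range L.sum, F (3 + x) := by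
  rw [Fin.sum_univ_eq_sum_range F n, ← hL, Finset.sum_range_add]
  simp [Finset.sum_range_succ]

lemma head_row_ge (hL : 3 + L.sum = n) {i : Fin n} (hi : 3 ≤ (i : ℕ)) :
    ∑ j, headBlocks n A3 L i j = gcount L (i - 3) := by
  obtain ⟨F, hF⟩ : ∃ F : ℕ → ℕ, F = fun y : ℕ => if y < 3 then 0 else
      if blockIdx L (i - 3) = blockIdx L (y - 3) then 1 else 0 := ⟨_, rfl⟩
  have : ∀ j : Fin n, headBlocks n A3 L i j = F j := by
    rw [hF]
    intro j
    by_cases hj : (j : ℕ) < 3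
    · rw [head_mixed (by omega)]; simp [hj]
    · rw [head_ge hi (by omega)]; simp only [hj, if_false]
  rw [Finset.sum_congr rfl (fun j _ => this j), sum_fin_split hL, hF]
  simp [gcount]

lemma head_row_lt (hL : 3 + L.sum = n) {i : Fin n} (hi : (i : ℕ) < 3) :
    ∑ j, headBlocks n A3 L i j = if (i : ℕ) = 0 then 2 else 3 := by
  obtain ⟨F, hF⟩ : ∃ F : ℕ → ℕ, F = fun y : ℕ => if y < 3 then
      if (i : ℕ) = 0 ∧ y = 0 then 0 else 1 else 0 := ⟨_, rfl⟩
  have : ∀ j : Fin n, headBlocks n A3 L i j = F j := by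
    rw [hF]
    intro j
    by_cases hj : (j : ℕ) < 3
    · rw [head_lt hi hj]; simp only [hj, if_true]
    · rw [head_mixed (by omega)]; simp only [hj, if_false]
  rw [Finset.sum_congr rfl (fun j _ => this j), sum_fin_split hL, hF]
  by_cases h0 : (i : ℕ) = 0 <;> simp [h0]

lemma head_sum (hL : 3 + L.sum = n) :
    ∑ i, ∑ j, headBlocks n A3 L i j = 8 + (L.map fun s => s * s).sum := by
  obtain ⟨F, hF⟩ : ∃ F : ℕ → ℕ, F = fun y : ℕ => if y < 3 then
      if y = 0 then 2 else 3 else gcount L (y - 3) := ⟨_, rfl⟩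
  have : ∀ i : Fin n, ∑ j, headBlocks n A3 L i j = F i := by
    rw [hF]
    intro i
    by_cases hi : (i : ℕ) < 3
    · rw [head_row_lt hL hi]; simp only [hi, if_true]
    · rw [head_row_ge hL (by omega)]; simp only [hi, if_false]
  rw [Finset.sum_congr rfl (fun j _ => this j), sum_fin_split hL, hF]
  simp [gcount_sum]

lemma bm_iff {M : Matrix (Fin n) (Fin n) ℕ} {i j : Fin n} : bm M i j = true ↔ M i j = 1 := by
  simp [bm]

lemma head_isN (hL : 3 + L.sum = n) (h23 : ∀ s ∈ L, s = 2 ∨ s = 3) :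
    IsN (bm (headBlocks n A3 L)) Finset.univ Finset.univ := by
  have h3 : 3 ≤ n := by omega
  have r0 : ∀ z : Fin n, (z : ℕ) = 0 →
      row (bm (headBlocks n A3 L)) Finset.univ z = (hd n).erase z := by
    intro z hz
    ext j
    rw [mem_row, bm_iff, Finset.mem_erase, mem_hd]
    by_cases hj : (j : ℕ) < 3
    · rw [head_lt (by omega) hj]; simp [hz, hj, Fin.ext_iff]
    · rw [head_mixed (by omega)]; simp [hj]
  have r1 : ∀ z : Fin n, (z : ℕ) < 3 → (z : ℕ) ≠ 0 →
      row (bm (headBlocks n A3 L)) Finset.univ z = hd n := by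
    intro z hz hz0
    ext j
    rw [mem_row, bm_iff, mem_hd]
    by_cases hj : (j : ℕ) < 3
    · rw [head_lt hz hj]; simp [hz0, hj]
    · rw [head_mixed (by omega)]; simp [hj]
  have r2 : ∀ i ∈ Finset.univ \ hd n,
      (row (bm (headBlocks n A3 L)) (Finset.univ \ hd n) i).card = gcount L (i - 3) := by
    intro i hi
    simp only [Finset.mem_sdiff, Finset.mem_univ, true_and, mem_hd] at hi
    rw [← head_row_ge hL (by omega)]
    unfold row
    rw [Finset.sdiff_eq_filter, Finset.filter_filter, Finset.card_filter]
    refine Finset.sum_congr rfl fun j _ => ?_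
    simp only [mem_hd, bm_iff]
    by_cases hj : (j : ℕ) < 3
    · rw [head_mixed (by omega)]; simp
    · rw [head_ge (by omega) (by omega)]; simp [hj]
  have rg : ∀ i : Fin n, 3 ≤ (i : ℕ) → gcount L (i - 3) = 2 ∨ gcount L (i - 3) = 3 := by
    intro i hi
    have := i.2
    exact h23 _ (gcount_mem L _ (by omega))
  let z : Fin n := ⟨0, by omega⟩
  have hz : (z : ℕ) = 0 := rfl
  have hzm : z ∈ hd n := by rw [mem_hd]; omega
  have hne : ∀ l : Fin n, l ≠ z → (l : ℕ) ≠ 0 := fun l hl h => hl (Fin.ext h)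
  refine ⟨hd n, hd n, z, z, Finset.subset_univ _, Finset.subset_univ _, hd_card h3, hd_card h3,
    hzm, hzm, r0 z hz, fun l hl hlz => r1 l (mem_hd.1 hl) (hne l hlz), ?_, ?_, ?_⟩
  · rw [head_tr]; exact r0 z hz
  · rw [head_tr]; exact fun l hl hlz => r1 l (mem_hd.1 hl) (hne l hlz)
  · have hm : ∀ i ∈ Finset.univ \ hd n, 3 ≤ (i : ℕ) := by
      intro i hi
      simpa [mem_hd] using hi
    have hen : ∀ i ∈ Finset.univ \ hd n, ∀ j ∈ Finset.univ \ hd n,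
        (bm (headBlocks n A3 L) i j = true ↔ blockIdx L (i - 3) = blockIdx L (j - 3)) := by
      intro i hi j hj
      rw [bm_iff, head_ge (hm i hi) (hm j hj)]
      simp
    refine ⟨fun i hi => ?_, fun i hi => ?_, fun i hi j hj h => ?_,
      fun i hi i' hi' j hj j' hj' a b c => ?_⟩
    · rw [r2 i hi]; exact rg i (hm i hi)
    · rw [head_tr, r2 i hi]; exact rg i (hm i hi)
    · rw [head_tr, r2 i hi, r2 j hj]
      unfold gcount
      rw [(hen i hi j hj).1 h]
    · rw [hen _ ‹_› _ ‹_›] at a b c ⊢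
      rw [b, ← a, c]

end Head

lemma key_num (a c : ℕ) :
    ((4 * 6 ^ a * 2 ^ c : ℕ) : ℝ) * w ^ (8 + 9 * a + 4 * c) * (3 / 2 * w) ^ (3 + 3 * a + 2 * c)
      = 3 * w ^ 5 := by
  have h6 := w6
  have e1 : 6 * (w ^ 9 * (3 / 2 * w) ^ 3) = 1 := by
    have : 6 * (w ^ 9 * (3 / 2 * w) ^ 3) = 81 / 4 * (w ^ 6) ^ 2 := by ring
    rw [this, h6]; norm_num
  have e2 : 2 * (w ^ 4 * (3 / 2 * w) ^ 2) = 1 := by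
    have : 2 * (w ^ 4 * (3 / 2 * w) ^ 2) = 9 / 2 * (w ^ 6) := by ring
    rw [this, h6]; norm_num
  have e3 : 4 * (w ^ 8 * (3 / 2 * w) ^ 3) = 3 * w ^ 5 := by
    have : 4 * (w ^ 8 * (3 / 2 * w) ^ 3) = 27 / 2 * (w ^ 6) * w ^ 5 := by ring
    rw [this, h6]; ring
  push_cast
  calc _ = (4 * (w ^ 8 * (3 / 2 * w) ^ 3)) * (6 * (w ^ 9 * (3 / 2 * w) ^ 3)) ^ a *
        (2 * (w ^ 4 * (3 / 2 * w) ^ 2)) ^ c := by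
        simp only [pow_add, pow_mul, mul_pow]; ring
    _ = _ := by rw [e1, e2, e3]; simp

lemma key_bound {n a c : ℕ} (hn : 3 + 3 * a + 2 * c = n) {M : Matrix (Fin n) (Fin n) ℕ}
    (hM : IsZeroOne M) (ho : ∑ i, ∑ j, M i j = 8 + 9 * a + 4 * c) :
    perm M ≤ 4 * 6 ^ a * 2 ^ c ∧
      (perm M = 4 * 6 ^ a * 2 ^ c ↔ IsN (bm M) Finset.univ Finset.univ) := by
  have hw := w_pos
  have hone := ones_eq M hM
  rw [ho] at hone
  have hD : D (bm M) Finset.univ Finset.univ =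
      (perm M : ℝ) * w ^ (8 + 9 * a + 4 * c) * (3 / 2 * w) ^ (3 + 3 * a + 2 * c) := by
    unfold D
    rw [hone, ← perm_eq_pr hM, Finset.card_univ, Fintype.card_fin, hn]
  have hk := key_num a c
  have hp : 0 < w ^ (8 + 9 * a + 4 * c) * (3 / 2 * w) ^ (3 + 3 * a + 2 * c) := by positivity
  obtain ⟨q1, q2⟩ := main_Q2 n (bm M) Finset.univ Finset.univ (by simp) (by simp)
    (by rw [hone]; omega)
  have hiff : D (bm M) Finset.univ Finset.univ = 3 * w ^ 5 ↔ perm M = 4 * 6 ^ a * 2 ^ c := by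
    rw [hD, ← hk, mul_assoc, mul_assoc, mul_left_inj' hp.ne']
    exact Nat.cast_inj
  refine ⟨?_, ?_, ?_⟩
  · rw [hD, ← hk, mul_assoc, mul_assoc] at q1
    exact_mod_cast le_of_mul_le_mul_right q1 hp
  · intro h; exact q2 (hiff.2 h)
  · intro h; exact hiff.1 (h.D_eq rfl)

end BGM

namespace BGM
theorem stmt8 (n τ σ : ℕ) (hn : 8 ≤ n)
    (hτ1 : n ^ 2 - 3 * n ≤ τ) (hτ2 : τ ≤ n ^ 2 - 2 * n - 1)
    (hσ : σ = n ^ 2 - τ)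
    (hmod : (σ - 2 * n) % 3 = 2) (hodd : Odd (3 * n - σ)) :
    mu n τ = 4 * 6 ^ ((σ - 2 * n) / 3) * 2 ^ ((3 * n - σ) / 2) ∧
    ∀ A ∈ Uclass n τ, (perm A = mu n τ ↔
      ((∃ a c : ℕ, 3 + 3*a + 2*c = n ∧
          headBlocks n A3 (List.replicate a 3 ++ List.replicate c 2) ∈ Uclass n τ ∧
          CombEquiv A (headBlocks n A3 (List.replicate a 3 ++ List.replicate c 2))))) := by
  have hnn : 8 * n ≤ n ^ 2 := by nlinarith
  have hb1 : σ ≤ 3 * n := by omega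
  have hb2 : 2 * n + 1 ≤ σ := by omega
  have hτσ : σ + τ = n ^ 2 := by omega
  have hodd2 : (3 * n - σ) % 2 = 1 := Nat.odd_iff.1 hodd
  obtain ⟨a, ha⟩ : ∃ a, (σ - 2 * n) / 3 = a := ⟨_, rfl⟩
  obtain ⟨c, hc⟩ : ∃ c, (3 * n - σ) / 2 = c := ⟨_, rfl⟩
  rw [ha, hc]
  have hnac : 3 + 3 * a + 2 * c = n := by omega
  have hσac : σ = 8 + 9 * a + 4 * c := by omega
  have hU : ∀ M : Matrix (Fin n) (Fin n) ℕ,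
      M ∈ Uclass n τ ↔ IsZeroOne M ∧ ∑ i, ∑ j, M i j = 8 + 9 * a + 4 * c := by
    intro M
    refine and_congr_right fun hM => ?_
    have := ones_add_zeroCount M hM
    omega
  have hsum : ∀ a' c' : ℕ, (List.replicate a' 3 ++ List.replicate c' 2).sum = 3 * a' + 2 * c' := by
    intro a' c'; simp; ring
  have h23 : ∀ a' c' : ℕ, ∀ s ∈ List.replicate a' 3 ++ List.replicate c' 2, s = 2 ∨ s = 3 := by
    intro a' c' s hs
    simp only [List.mem_append, List.mem_replicate] at hs
    tauto
  have hHN : ∀ a' c' : ℕ, 3 + 3 * a' + 2 * c' = n →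
      IsN (bm (headBlocks n A3 (List.replicate a' 3 ++ List.replicate c' 2)))
        Finset.univ Finset.univ := fun a' c' h =>
    head_isN (by rw [hsum]; omega) (h23 a' c')
  have hHU : headBlocks n A3 (List.replicate a 3 ++ List.replicate c 2) ∈ Uclass n τ := by
    rw [hU]
    refine ⟨head_zeroOne, ?_⟩
    rw [head_sum (by rw [hsum]; omega)]
    simp
    ring
  have hmu : mu n τ = 4 * 6 ^ a * 2 ^ c := by
    unfold mu
    refine IsGreatest.csSup_eq ⟨⟨_, hHU, ?_⟩, ?_⟩
    · have := (hU _).1 hHU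
      exact (key_bound hnac this.1 this.2).2.2 (hHN a c hnac)
    · rintro _ ⟨M, hM, rfl⟩
      have := (hU _).1 hM
      exact (key_bound hnac this.1 this.2).1
  refine ⟨hmu, ?_⟩
  intro A hA
  have hA' := (hU _).1 hA
  rw [hmu]
  constructor
  · intro h
    refine ⟨a, c, hnac, hHU, ?_⟩
    have hAN := (key_bound hnac hA'.1 hA'.2).2.1 h
    have hH := (hU _).1 hHU
    refine combEquiv_of_iso hA'.1 hH.1 (IsN.iso rfl rfl rfl (hHN a c hnac) hAN ?_)
    rw [ones_eq _ hH.1, ones_eq _ hA'.1, hH.2, hA'.2]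
  · rintro ⟨a', c', h1, h2, h3⟩
    have hH := (hU _).1 h2
    rw [← h3.perm_eq]
    exact (key_bound hnac hH.1 hH.2).2.2 (hHN a' c' h1)

end BGM
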